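/- arXiv:2502.18876 — 3 statements merged into one kernel-verified Lean document; each statement's English description precedes it below -/
import Mathlib

section
/- Let 𝕄ʷ = { (q_1, q_2) : q_1, q_2 : [0,1] → [0,1] nondecreasing and left-continuous, and q_1 ⪯_w q̂_2 }. Then 𝕄ʷ is convex, and every extreme point q = (q_1, q_2) of 𝕄ʷ satisfies: there exists k ∈ [0,1] such that for almost every z ∈ [0,1], q_1(z) = q̂_2(z) if z ≥ k and q_1(z) = 0 if z < k. -/
open MeasureTheory

noncomputable section

/-- The closed unit square `[0,1]²`. -/
def unitSq : Set (ℝ × ℝ) := Set.Icc 0 1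

/-- `q : [0,1] → [0,1]` is nondecreasing and left-continuous. -/
def MonoLC (q : ℝ → ℝ) : Prop :=
  MonotoneOn q (Set.Icc 0 1) ∧
  (∀ t ∈ Set.Icc (0 : ℝ) 1, q t ∈ Set.Icc (0 : ℝ) 1) ∧
  ∀ t ∈ Set.Ioc (0 : ℝ) 1, Filter.Tendsto q (nhdsWithin t (Set.Iio t)) (nhds (q t))

/-- `f : [0,1]² → [0,1]` rationalizes the pair `(q₁, q₂)`: the `qᵢ` are (a.e.) the
one-dimensional marginals of `f`. -/
def Rat2 (f : ℝ × ℝ → ℝ) (q₁ q₂ : ℝ → ℝ) : Prop :=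
  AEMeasurable f (volume.restrict unitSq) ∧
  (∀ x ∈ unitSq, f x ∈ Set.Icc (0 : ℝ) 1) ∧
  (∀ᵐ t ∂(volume.restrict (Set.Icc (0 : ℝ) 1)),
    q₁ t = ∫ y in Set.Icc (0 : ℝ) 1, f (t, y)) ∧
  (∀ᵐ t ∂(volume.restrict (Set.Icc (0 : ℝ) 1)),
    q₂ t = ∫ y in Set.Icc (0 : ℝ) 1, f (y, t))

/-- The set `𝒬` of rationalizable pairs of nondecreasing left-continuous functions. -/
def Q2 : Set ((ℝ → ℝ) × (ℝ → ℝ)) :=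
  {q | MonoLC q.1 ∧ MonoLC q.2 ∧ ∃ f, Rat2 f q.1 q.2}

/-- `A` is an up-set of the square `[0,1]²`. -/
def UpSet2 (A : Set (ℝ × ℝ)) : Prop :=
  A ⊆ unitSq ∧ ∀ x ∈ A, ∀ y ∈ unitSq, x ≤ y → y ∈ A

/-- `q` is an extreme point of a set `S` of pairs of functions on `[0,1]`, with
componentwise convex combinations (only the values on `[0,1]` matter). -/
def ExtremePt2 (S : Set ((ℝ → ℝ) × (ℝ → ℝ))) (q : (ℝ → ℝ) × (ℝ → ℝ)) : Prop :=
  q ∈ S ∧ ∀ q' ∈ S, ∀ q'' ∈ S, ∀ l : ℝ, 0 < l → l < 1 →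
    (∀ t ∈ Set.Icc (0 : ℝ) 1,
      q.1 t = l * q'.1 t + (1 - l) * q''.1 t ∧
      q.2 t = l * q'.2 t + (1 - l) * q''.2 t) →
    ∀ t ∈ Set.Icc (0 : ℝ) 1, q'.1 t = q''.1 t ∧ q'.2 t = q''.2 t

/-- Generalized inverse `g⁻¹(z) = inf { x ∈ [0,1] : g x > z }`, with `inf ∅ := 1`. -/
def ginv (g : ℝ → ℝ) (z : ℝ) : ℝ :=
  sInf (insert 1 {x | x ∈ Set.Icc (0 : ℝ) 1 ∧ z < g x})

/-- The conjugate `ĝ(z) = 1 − g⁻¹(1 − z)` of a nondecreasing left-continuous function. -/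
def conj (g : ℝ → ℝ) (z : ℝ) : ℝ := 1 - ginv g (1 - z)

/-- `g₂` weakly majorizes `g₁`: `∫_x^1 g₁ ≤ ∫_x^1 g₂` for all `x ∈ [0,1]`. -/
def WeakMaj (g₁ g₂ : ℝ → ℝ) : Prop :=
  ∀ x ∈ Set.Icc (0 : ℝ) 1, (∫ z in x..1, g₁ z) ≤ ∫ z in x..1, g₂ z

/-- The weak joint majorization set `𝕄ʷ`. -/
def Mw : Set ((ℝ → ℝ) × (ℝ → ℝ)) :=
  {q | MonoLC q.1 ∧ MonoLC q.2 ∧ WeakMaj q.1 (conj q.2)}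

lemma MonoLC.intervalIntegrable {g : ℝ → ℝ} (hg : MonoLC g) {a b : ℝ}
    (ha : a ∈ Set.Icc (0 : ℝ) 1) (hb : b ∈ Set.Icc (0 : ℝ) 1) :
    IntervalIntegrable g volume a b :=
  (hg.1.mono (Set.uIcc_subset_Icc ha hb)).intervalIntegrable

lemma zero_mem_I : (0 : ℝ) ∈ Set.Icc (0 : ℝ) 1 := ⟨le_rfl, zero_le_one⟩

lemma one_mem_I : (1 : ℝ) ∈ Set.Icc (0 : ℝ) 1 := ⟨zero_le_one, le_rfl⟩

lemma ginv_bddBelow (g : ℝ → ℝ) (w : ℝ) :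
    BddBelow (insert 1 {x | x ∈ Set.Icc (0 : ℝ) 1 ∧ w < g x}) := by
  refine ⟨0, ?_⟩
  rintro x (rfl | hx)
  · exact zero_le_one
  · exact hx.1.1

lemma ginv_mem (g : ℝ → ℝ) (w : ℝ) : ginv g w ∈ Set.Icc (0 : ℝ) 1 := by
  refine ⟨le_csInf ⟨1, Or.inl rfl⟩ ?_, csInf_le (ginv_bddBelow g w) (Or.inl rfl)⟩
  rintro x (rfl | hx)
  · exact zero_le_one
  · exact hx.1.1

lemma ginv_monotone (g : ℝ → ℝ) : Monotone (ginv g) := by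
  intro v w hvw
  refine csInf_le_csInf (ginv_bddBelow g v) ⟨1, Or.inl rfl⟩ ?_
  exact Set.insert_subset_insert fun x hx => ⟨hx.1, hvw.trans_lt hx.2⟩

lemma lt_of_ginv_lt {g : ℝ → ℝ} (hg : MonoLC g) {w y : ℝ} (hy : y ∈ Set.Icc (0 : ℝ) 1)
    (h : ginv g w < y) : w < g y := by
  obtain ⟨x, hx, hxy⟩ := exists_lt_of_csInf_lt (Set.insert_nonempty _ _) h
  rcases hx with rfl | hx
  · exact absurd hxy (not_lt.2 hy.2)
  · exact hx.2.trans_le (hg.1 hx.1 hy hxy.le)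

lemma ginv_le_of_lt {g : ℝ → ℝ} {w y : ℝ} (hy : y ∈ Set.Icc (0 : ℝ) 1)
    (h : w < g y) : ginv g w ≤ y :=
  csInf_le (ginv_bddBelow g w) (Or.inr ⟨hy, h⟩)

lemma measureReal_lt_eq {g : ℝ → ℝ} (hg : MonoLC g) (w : ℝ) :
    (volume.restrict (Set.Icc (0 : ℝ) 1)).real {y | w < g y} = 1 - ginv g w := by
  have hm := ginv_mem g w
  have h1 : Set.Ioc (ginv g w) 1 ⊆ {y | w < g y} := fun y hy =>
    lt_of_ginv_lt hg ⟨hm.1.trans hy.1.le, hy.2⟩ hy.1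
  have h2 : {y | w < g y} ∩ Set.Icc (0 : ℝ) 1 ⊆ Set.Icc (ginv g w) 1 := fun y hy =>
    ⟨ginv_le_of_lt hy.2 hy.1, hy.2.2⟩
  have e1 : (volume.restrict (Set.Icc (0 : ℝ) 1)).real (Set.Ioc (ginv g w) 1)
      = 1 - ginv g w := by
    rw [measureReal_restrict_apply measurableSet_Ioc, Set.inter_eq_left.2]
    · simp [Measure.real, hm.2]
    · exact fun y hy => ⟨hm.1.trans hy.1.le, hy.2⟩
  refine le_antisymm ?_ (e1 ▸ measureReal_mono h1)
  rw [measureReal_restrict_apply' measurableSet_Icc]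
  refine (measureReal_mono h2 (by simp)).trans ?_
  simp [Measure.real, hm.2]

lemma integral_min_eq {g : ℝ → ℝ} (hg : MonoLC g) {w : ℝ} (hw : 0 ≤ w) :
    ∫ y in (0 : ℝ)..1, min (g y) w = ∫ s in (0 : ℝ)..w, (1 - ginv g s) := by
  have hmono : MonotoneOn (fun y => min (g y) w) (Set.Icc 0 1) :=
    fun x hx y hy hxy => min_le_min_right w (hg.1 hx hy hxy)
  have hint : Integrable (fun y => min (g y) w) (volume.restrict (Set.Icc (0 : ℝ) 1)) :=
    hmono.integrableOn_isCompact isCompact_Icc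
  have hnn : 0 ≤ᵐ[volume.restrict (Set.Icc (0 : ℝ) 1)] fun y => min (g y) w := by
    rw [Filter.EventuallyLE, ae_restrict_iff' measurableSet_Icc]
    exact Filter.Eventually.of_forall fun y hy => le_min (hg.2.1 y hy).1 hw
  rw [intervalIntegral.integral_of_le zero_le_one, ← integral_Icc_eq_integral_Ioc,
    hint.integral_eq_integral_meas_lt hnn, intervalIntegral.integral_of_le hw,
    integral_Ioc_eq_integral_Ioo]
  have : ∀ s, (volume.restrict (Set.Icc (0 : ℝ) 1)).real {y | s < min (g y) w}
      = (Set.Iio w).indicator (fun s => 1 - ginv g s) s := by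
    intro s
    by_cases hs : s < w
    · rw [Set.indicator_of_mem (Set.mem_Iio.2 hs), ← measureReal_lt_eq hg]
      simp [hs]
    · rw [Set.indicator_of_notMem (by simpa using hs)]
      simp [hs]
  simp_rw [this]
  rw [setIntegral_indicator measurableSet_Iio]
  rfl

lemma integral_conj_eq {g : ℝ → ℝ} (hg : MonoLC g) {x : ℝ} (hx : x ≤ 1) :
    ∫ z in x..1, conj g z = ∫ y in (0 : ℝ)..1, min (g y) (1 - x) := by
  rw [integral_min_eq hg (sub_nonneg.2 hx)]
  have := intervalIntegral.integral_comp_sub_left (a := x) (b := 1)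
    (fun s => 1 - ginv g s) (1 : ℝ)
  simpa [conj] using this

lemma conj_intervalIntegrable (g : ℝ → ℝ) (a b : ℝ) :
    IntervalIntegrable (conj g) volume a b := by
  have : Monotone (conj g) := fun x y hxy =>
    sub_le_sub_left (ginv_monotone g (sub_le_sub_left hxy 1)) 1
  exact this.intervalIntegrable

/-- The slack of the linear constraint, indexed by `(x, y)`, in the rectangle form of weak
majorization. -/
def gap (c : ℝ) (p q : ℝ → ℝ) (x y : ℝ) : ℝ :=
  (∫ z in (0 : ℝ)..x, p z) + (∫ z in (0 : ℝ)..y, q z) + (1 - x) * (1 - y) - c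

lemma gap_comm (c : ℝ) (p q : ℝ → ℝ) (x y : ℝ) : gap c p q x y = gap c q p y x := by
  unfold gap; ring

lemma gap_eq {p q : ℝ → ℝ} (hp : MonoLC p) {x y : ℝ} (hx : x ∈ Set.Icc (0 : ℝ) 1) :
    gap (∫ z in (0 : ℝ)..1, p z) p q x y
      = (∫ z in (0 : ℝ)..y, q z) + (1 - x) * (1 - y) - ∫ z in x..1, p z := by
  unfold gap
  rw [← intervalIntegral.integral_add_adjacent_intervals
    (hp.intervalIntegrable zero_mem_I hx) (hp.intervalIntegrable hx one_mem_I)]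
  ring

lemma integral_min_le {g : ℝ → ℝ} (hg : MonoLC g) (w : ℝ) {y : ℝ}
    (hy : y ∈ Set.Icc (0 : ℝ) 1) :
    ∫ z in (0 : ℝ)..1, min (g z) w ≤ (∫ z in (0 : ℝ)..y, g z) + w * (1 - y) := by
  have hmono : MonotoneOn (fun y => min (g y) w) (Set.Icc 0 1) :=
    fun x hx y hy hxy => min_le_min_right w (hg.1 hx hy hxy)
  have hi : ∀ {a b : ℝ}, a ∈ Set.Icc (0 : ℝ) 1 → b ∈ Set.Icc (0 : ℝ) 1 →
      IntervalIntegrable (fun y => min (g y) w) volume a b := fun ha hb =>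
    (hmono.mono (Set.uIcc_subset_Icc ha hb)).intervalIntegrable
  rw [← intervalIntegral.integral_add_adjacent_intervals (hi zero_mem_I hy) (hi hy one_mem_I)]
  refine add_le_add ?_ ?_
  · exact intervalIntegral.integral_mono_on hy.1 (hi zero_mem_I hy)
      (hg.intervalIntegrable zero_mem_I hy) fun z _ => min_le_left _ _
  · calc _ ≤ ∫ z in y..1, w := intervalIntegral.integral_mono_on hy.2 (hi hy one_mem_I)
          intervalIntegrable_const fun z _ => min_le_right _ _
      _ = _ := by simp [mul_comm]

lemma integral_min_eq_ginv {g : ℝ → ℝ} (hg : MonoLC g) (w : ℝ) :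
    ∫ z in (0 : ℝ)..1, min (g z) w
      = (∫ z in (0 : ℝ)..(ginv g w), g z) + w * (1 - ginv g w) := by
  have hy := ginv_mem g w
  have hmono : MonotoneOn (fun y => min (g y) w) (Set.Icc 0 1) :=
    fun x hx y hy hxy => min_le_min_right w (hg.1 hx hy hxy)
  have hi : ∀ {a b : ℝ}, a ∈ Set.Icc (0 : ℝ) 1 → b ∈ Set.Icc (0 : ℝ) 1 →
      IntervalIntegrable (fun y => min (g y) w) volume a b := fun ha hb =>
    (hmono.mono (Set.uIcc_subset_Icc ha hb)).intervalIntegrable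
  refine le_antisymm (integral_min_le hg w hy) ?_
  rw [← intervalIntegral.integral_add_adjacent_intervals (hi zero_mem_I hy) (hi hy one_mem_I)]
  refine add_le_add ?_ ?_
  · refine intervalIntegral.integral_mono_on_of_le_Ioo hy.1 (hg.intervalIntegrable zero_mem_I hy)
      (hi zero_mem_I hy) fun z hz => le_min le_rfl ?_
    by_contra! h
    exact absurd hz.2 (not_lt.2 (ginv_le_of_lt ⟨hz.1.le, hz.2.le.trans hy.2⟩ h))
  · calc w * (1 - ginv g w) = ∫ z in (ginv g w)..1, w := by simp [mul_comm]
      _ ≤ _ := intervalIntegral.integral_mono_on_of_le_Ioo hy.2 intervalIntegrable_const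
          (hi hy one_mem_I) fun z hz => le_min
            (lt_of_ginv_lt hg ⟨hy.1.trans hz.1.le, hz.2.le⟩ hz.1).le le_rfl

lemma mem_Mw_iff {q : (ℝ → ℝ) × (ℝ → ℝ)} :
    q ∈ Mw ↔ MonoLC q.1 ∧ MonoLC q.2 ∧ ∀ x ∈ Set.Icc (0 : ℝ) 1, ∀ y ∈ Set.Icc (0 : ℝ) 1,
      0 ≤ gap (∫ z in (0 : ℝ)..1, q.1 z) q.1 q.2 x y := by
  refine and_congr_right fun h1 => and_congr_right fun h2 => forall₂_congr fun x hx => ?_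
  rw [integral_conj_eq h2 hx.2]
  constructor
  · intro h y hy
    rw [gap_eq h1 hx]
    linarith [integral_min_le h2 (1 - x) hy]
  · intro h
    have := h _ (ginv_mem q.2 (1 - x))
    rw [gap_eq h1 hx] at this
    linarith [integral_min_eq_ginv h2 (1 - x)]

lemma gap_combo {p p' q q' : ℝ → ℝ} (hp : MonoLC p) (hp' : MonoLC p') (hq : MonoLC q)
    (hq' : MonoLC q') (c c' : ℝ) {a b x y : ℝ} (hab : a + b = 1)
    (hx : x ∈ Set.Icc (0 : ℝ) 1) (hy : y ∈ Set.Icc (0 : ℝ) 1) :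
    gap (a * c + b * c') (fun z => a * p z + b * p' z) (fun z => a * q z + b * q' z) x y
      = a * gap c p q x y + b * gap c' p' q' x y := by
  unfold gap
  rw [intervalIntegral.integral_add, intervalIntegral.integral_add]
  · simp only [intervalIntegral.integral_const_mul]
    obtain rfl : b = 1 - a := by linarith
    ring
  · exact (hq.intervalIntegrable zero_mem_I hy).const_mul a
  · exact (hq'.intervalIntegrable zero_mem_I hy).const_mul b
  · exact (hp.intervalIntegrable zero_mem_I hx).const_mul a
  · exact (hp'.intervalIntegrable zero_mem_I hx).const_mul b

lemma MonoLC.combo {p p' : ℝ → ℝ} (hp : MonoLC p) (hp' : MonoLC p') {a b : ℝ}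
    (ha : 0 ≤ a) (hb : 0 ≤ b) (hab : a + b = 1) :
    MonoLC (fun z => a * p z + b * p' z) := by
  refine ⟨fun x hx y hy hxy => ?_, fun t ht => ?_, fun t ht => ?_⟩
  · exact add_le_add (mul_le_mul_of_nonneg_left (hp.1 hx hy hxy) ha)
      (mul_le_mul_of_nonneg_left (hp'.1 hx hy hxy) hb)
  · exact (convex_Icc (0 : ℝ) 1) (hp.2.1 t ht) (hp'.2.1 t ht) ha hb hab
  · exact ((hp.2.2 t ht).const_mul a).add ((hp'.2.2 t ht).const_mul b)

lemma convex_Mw : Convex ℝ Mw := by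
  intro q hq q' hq' a b ha hb hab
  rw [mem_Mw_iff] at hq hq' ⊢
  refine ⟨hq.1.combo hq'.1 ha hb hab, hq.2.1.combo hq'.2.1 ha hb hab, fun x hx y hy => ?_⟩
  have h := gap_combo hq.1 hq'.1 hq.2.1 hq'.2.1 (∫ z in (0 : ℝ)..1, q.1 z)
    (∫ z in (0 : ℝ)..1, q'.1 z) hab hx hy
  have e : (∫ z in (0 : ℝ)..1, (a • q + b • q').1 z)
      = a * (∫ z in (0 : ℝ)..1, q.1 z) + b * ∫ z in (0 : ℝ)..1, q'.1 z := by
    rw [← intervalIntegral.integral_const_mul, ← intervalIntegral.integral_const_mul,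
      ← intervalIntegral.integral_add ((hq.1.intervalIntegrable zero_mem_I one_mem_I).const_mul a)
      ((hq'.1.intervalIntegrable zero_mem_I one_mem_I).const_mul b)]
    rfl
  rw [e]
  refine le_of_le_of_eq ?_ h.symm
  exact add_nonneg (mul_nonneg ha (hq.2.2 x hx y hy)) (mul_nonneg hb (hq'.2.2 x hx y hy))

lemma gap_sub_left (c : ℝ) {p : ℝ → ℝ} (q : ℝ → ℝ) (hp : MonoLC p) {x x' : ℝ} (y : ℝ)
    (hx : x ∈ Set.Icc (0 : ℝ) 1) (hx' : x' ∈ Set.Icc (0 : ℝ) 1) :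
    gap c p q x' y - gap c p q x y = ∫ z in x..x', (p z - (1 - y)) := by
  rw [intervalIntegral.integral_sub (hp.intervalIntegrable hx hx') intervalIntegrable_const,
    ← intervalIntegral.integral_interval_sub_left (hp.intervalIntegrable zero_mem_I hx')
      (hp.intervalIntegrable zero_mem_I hx)]
  simp only [gap, intervalIntegral.integral_const, smul_eq_mul]
  ring

lemma gap_sub_right (c : ℝ) (p : ℝ → ℝ) {q : ℝ → ℝ} (hq : MonoLC q) (x : ℝ) {y y' : ℝ}
    (hy : y ∈ Set.Icc (0 : ℝ) 1) (hy' : y' ∈ Set.Icc (0 : ℝ) 1) :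
    gap c p q x y' - gap c p q x y = ∫ z in y..y', (q z - (1 - x)) := by
  rw [gap_comm, gap_comm c p q x y]
  exact gap_sub_left c p hq x hy hy'

lemma MonoLC.intervalIntegrable_sub {p : ℝ → ℝ} (hp : MonoLC p) (v : ℝ) {x x' : ℝ}
    (hx : x ∈ Set.Icc (0 : ℝ) 1) (hx' : x' ∈ Set.Icc (0 : ℝ) 1) :
    IntervalIntegrable (fun z => p z - v) volume x x' :=
  (hp.intervalIntegrable hx hx').sub intervalIntegrable_const

lemma le_of_gap_eq_zero {c : ℝ} {p q : ℝ → ℝ} (hp : MonoLC p) {x x' y : ℝ}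
    (hx : x ∈ Set.Icc (0 : ℝ) 1) (hx' : x' ∈ Set.Icc (0 : ℝ) 1) (h0 : gap c p q x y = 0)
    (hn : 0 ≤ gap c p q x' y) (hlt : x' < x) : p x' ≤ 1 - y := by
  by_contra! h
  have := intervalIntegral.intervalIntegral_pos_of_pos_on
    (hp.intervalIntegrable_sub (1 - y) hx' hx) (fun z hz => sub_pos.2 (h.trans_le
      (hp.1 hx' ⟨hx'.1.trans hz.1.le, hz.2.le.trans hx.2⟩ hz.1.le))) hlt
  linarith [gap_sub_left c q hp y hx' hx]

lemma ge_of_gap_eq_zero {c : ℝ} {p q : ℝ → ℝ} (hp : MonoLC p) {x x' y : ℝ}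
    (hx : x ∈ Set.Icc (0 : ℝ) 1) (hx' : x' ∈ Set.Icc (0 : ℝ) 1) (h0 : gap c p q x y = 0)
    (hn : 0 ≤ gap c p q x' y) (hlt : x < x') : 1 - y ≤ p x' := by
  by_contra! h
  have := intervalIntegral.intervalIntegral_pos_of_pos_on
    (hp.intervalIntegrable_sub (1 - y) hx hx').neg (fun z hz => neg_pos.2 (sub_neg.2
      ((hp.1 ⟨hx.1.trans hz.1.le, hz.2.le.trans hx'.2⟩ hx' hz.2.le).trans_lt h))) hlt
  simp only [Pi.neg_apply, intervalIntegral.integral_neg] at this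
  linarith [gap_sub_left c q hp y hx hx']

lemma lt_of_gap_pos {c : ℝ} {p q : ℝ → ℝ} (hp : MonoLC p) {x x' y : ℝ}
    (hx : x ∈ Set.Icc (0 : ℝ) 1) (hx' : x' ∈ Set.Icc (0 : ℝ) 1) (h0 : gap c p q x y = 0)
    (hn : 0 < gap c p q x' y) (hlt : x < x') : 1 - y < p x' := by
  by_contra! h
  have := intervalIntegral.integral_nonneg (μ := volume) (f := fun z => -(p z - (1 - y)))
    hlt.le (fun z hz => neg_nonneg.2 (sub_nonpos.2
      ((hp.1 ⟨hx.1.trans hz.1, hz.2.trans hx'.2⟩ hx' hz.2).trans h)))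
  rw [intervalIntegral.integral_neg] at this
  linarith [gap_sub_left c q hp y hx hx']

lemma gt_of_gap_pos {c : ℝ} {p q : ℝ → ℝ} (hp : MonoLC p) {x x' y : ℝ}
    (hx : x ∈ Set.Icc (0 : ℝ) 1) (hx' : x' ∈ Set.Icc (0 : ℝ) 1) (h0 : gap c p q x y = 0)
    (hn : 0 < gap c p q x' y) (hlt : x' < x) : p x' < 1 - y := by
  by_contra! h
  have := intervalIntegral.integral_nonneg (μ := volume) (f := fun z => p z - (1 - y))
    hlt.le (fun z hz => sub_nonneg.2 (h.trans
      (hp.1 hx' ⟨hx'.1.trans hz.1, hz.2.trans hx.2⟩ hz.1)))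
  linarith [gap_sub_left c q hp y hx' hx]

lemma continuousOn_primitive_I {p : ℝ → ℝ} (hp : MonoLC p) :
    ContinuousOn (fun x => ∫ z in (0 : ℝ)..x, p z) (Set.Icc 0 1) := by
  have := intervalIntegral.continuousOn_primitive_interval'
    (hp.intervalIntegrable zero_mem_I one_mem_I) (Set.left_mem_uIcc)
  rwa [Set.uIcc_of_le zero_le_one] at this

lemma continuousOn_gap (c : ℝ) {p q : ℝ → ℝ} (hp : MonoLC p) (hq : MonoLC q) :
    ContinuousOn (fun z : ℝ × ℝ => gap c p q z.1 z.2) (Set.Icc 0 1 ×ˢ Set.Icc 0 1) := by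
  unfold gap
  have h1 := (continuousOn_primitive_I hp).comp (s := Set.Icc (0 : ℝ) 1 ×ˢ Set.Icc (0 : ℝ) 1)
    continuousOn_fst (fun z hz => hz.1)
  have h2 := (continuousOn_primitive_I hq).comp (s := Set.Icc (0 : ℝ) 1 ×ˢ Set.Icc (0 : ℝ) 1)
    continuousOn_snd (fun z hz => hz.2)
  have h3 : Continuous fun z : ℝ × ℝ => (1 - z.1) * (1 - z.2) := by fun_prop
  exact ((h1.add h2).add h3.continuousOn).sub continuousOn_const

lemma exists_pos_le_gap (c : ℝ) {p q : ℝ → ℝ} (hp : MonoLC p) (hq : MonoLC q) {a b u v : ℝ}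
    (ha : 0 ≤ a) (hb : b ≤ 1) (hu : 0 ≤ u) (hv : v ≤ 1)
    (h : ∀ x ∈ Set.Icc a b, ∀ y ∈ Set.Icc u v, 0 < gap c p q x y) :
    ∃ e, 0 < e ∧ ∀ x ∈ Set.Icc a b, ∀ y ∈ Set.Icc u v, e ≤ gap c p q x y := by
  obtain ⟨e, he, H⟩ := (isCompact_Icc.prod isCompact_Icc).exists_forall_le'
    ((continuousOn_gap c hp hq).mono (Set.prod_mono (Set.Icc_subset_Icc ha hb)
      (Set.Icc_subset_Icc hu hv))) (a := 0) fun z hz => h z.1 hz.1 z.2 hz.2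
  exact ⟨e, he, fun x hx y hy => H (x, y) ⟨hx, hy⟩⟩

/-- A `1`-Lipschitz function vanishing outside `(0, 1)`. -/
def IsBump (ψ : ℝ → ℝ) : Prop :=
  (∀ u v, |ψ u - ψ v| ≤ |u - v|) ∧ (∀ v ≤ 0, ψ v = 0) ∧ ∀ v, 1 ≤ v → ψ v = 0

lemma IsBump.combo {ψ χ : ℝ → ℝ} (hψ : IsBump ψ) (hχ : IsBump χ) {s t : ℝ}
    (h : |s| + |t| ≤ 1) : IsBump fun v => s * ψ v + t * χ v := by
  refine ⟨fun u v => ?_, fun v hv => ?_, fun v hv => ?_⟩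
  · calc |s * ψ u + t * χ u - (s * ψ v + t * χ v)|
        = |s * (ψ u - ψ v) + t * (χ u - χ v)| := by ring_nf
      _ ≤ |s| * |ψ u - ψ v| + |t| * |χ u - χ v| := by
          rw [← abs_mul, ← abs_mul]; exact abs_add_le _ _
      _ ≤ |s| * |u - v| + |t| * |u - v| := by
          exact add_le_add (mul_le_mul_of_nonneg_left (hψ.1 u v) (abs_nonneg s))
            (mul_le_mul_of_nonneg_left (hχ.1 u v) (abs_nonneg t))
      _ ≤ |u - v| := by
          rw [← add_mul]; exact mul_le_of_le_one_left (abs_nonneg _) h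
  · simp [hψ.2.1 v hv, hχ.2.1 v hv]
  · simp [hψ.2.2 v hv, hχ.2.2 v hv]

lemma isBump_zero : IsBump fun _ => 0 := ⟨by simp, by simp, by simp⟩

lemma IsBump.const_mul {ψ : ℝ → ℝ} (hψ : IsBump ψ) {s : ℝ} (h : |s| ≤ 1) :
    IsBump fun v => s * ψ v := by
  simpa using hψ.combo isBump_zero (s := s) (t := 0) (by simpa using h)

/-- The tent function supported on `[c, d]` with slopes `1` and `-1`. -/
def tent (c d v : ℝ) : ℝ := max 0 (min (v - c) (d - v))

lemma isBump_tent {c d : ℝ} (hc : 0 ≤ c) (hd : d ≤ 1) : IsBump (tent c d) := by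
  refine ⟨fun u v => ?_, fun v hv => ?_, fun v hv => ?_⟩
  · unfold tent
    grind
  · exact max_eq_left ((min_le_left _ _).trans (by linarith))
  · exact max_eq_left ((min_le_right _ _).trans (by linarith))

lemma tent_nonneg (c d v : ℝ) : 0 ≤ tent c d v := le_max_left _ _

lemma tent_pos {c d v : ℝ} (h1 : c < v) (h2 : v < d) : 0 < tent c d v :=
  lt_max_of_lt_right (lt_min (sub_pos.2 h1) (sub_pos.2 h2))

lemma tent_eq_zero_of_le {c d v : ℝ} (h : v ≤ c) : tent c d v = 0 :=
  max_eq_left ((min_le_left _ _).trans (sub_nonpos.2 h))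

lemma tent_eq_zero_of_ge {c d v : ℝ} (h : d ≤ v) : tent c d v = 0 :=
  max_eq_left ((min_le_right _ _).trans (sub_nonpos.2 h))

lemma tent_le_left {c d v : ℝ} (h : c ≤ v) : tent c d v ≤ v - c :=
  max_le (sub_nonneg.2 h) (min_le_left _ _)

lemma tent_le_right {c d v : ℝ} (h : v ≤ d) : tent c d v ≤ d - v :=
  max_le (sub_nonneg.2 h) (min_le_right _ _)

lemma IsBump.abs_le {ψ : ℝ → ℝ} (hψ : IsBump ψ) {v : ℝ} (hv : v ∈ Set.Icc (0 : ℝ) 1) :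
    |ψ v| ≤ 1 := by
  have := hψ.1 v 0
  rw [hψ.2.1 0 le_rfl, sub_zero, sub_zero, abs_of_nonneg hv.1] at this
  exact this.trans hv.2

lemma MonoLC.add_bump {g ψ : ℝ → ℝ} (hg : MonoLC g) (hψ : IsBump ψ) :
    MonoLC fun z => g z + ψ (g z) := by
  have hc : Continuous ψ :=
    (LipschitzWith.of_dist_le_mul (K := 1) fun u v => by
      simpa [Real.dist_eq] using hψ.1 u v).continuous
  refine ⟨fun x hx y hy hxy => ?_, fun t ht => ⟨?_, ?_⟩, fun t ht => ?_⟩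
  · have h := hψ.1 (g x) (g y)
    rw [abs_sub_comm (g x), abs_of_nonneg (sub_nonneg.2 (hg.1 hx hy hxy))] at h
    have := (abs_le.1 h).2
    simp only
    linarith
  · have h := hψ.1 (g t) 0
    rw [hψ.2.1 0 le_rfl, sub_zero, sub_zero, abs_of_nonneg (hg.2.1 t ht).1] at h
    linarith [(abs_le.1 h).1]
  · have h := hψ.1 (g t) 1
    rw [hψ.2.2 1 le_rfl, sub_zero, abs_sub_comm,
      abs_of_nonneg (sub_nonneg.2 (hg.2.1 t ht).2)] at h
    linarith [(abs_le.1 h).2]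
  · exact (hg.2.2 t ht).add ((hc.tendsto (g t)).comp (hg.2.2 t ht))

lemma MonoLC.intervalIntegrable_bump {g ψ : ℝ → ℝ} (hg : MonoLC g) (hψ : IsBump ψ) {a b : ℝ}
    (ha : a ∈ Set.Icc (0 : ℝ) 1) (hb : b ∈ Set.Icc (0 : ℝ) 1) :
    IntervalIntegrable (fun z => ψ (g z)) volume a b := by
  simpa using ((hg.add_bump hψ).intervalIntegrable ha hb).sub (hg.intervalIntegrable ha hb)

lemma MonoLC.abs_integral_bump_le {g ψ : ℝ → ℝ} (hg : MonoLC g) (hψ : IsBump ψ) {a b : ℝ}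
    (ha : a ∈ Set.Icc (0 : ℝ) 1) (hb : b ∈ Set.Icc (0 : ℝ) 1) :
    |∫ z in a..b, ψ (g z)| ≤ 1 := by
  have h := intervalIntegral.norm_integral_le_of_norm_le_const (a := a) (b := b) (C := 1)
    (f := fun z => ψ (g z)) fun z hz => hψ.abs_le (hg.2.1 z
      (Set.uIcc_subset_Icc ha hb (Set.uIoc_subset_uIcc hz)))
  rw [Real.norm_eq_abs, one_mul] at h
  refine h.trans (abs_le.2 ⟨?_, ?_⟩) <;> linarith [ha.1, ha.2, hb.1, hb.2]

lemma add_bump_mem_Mw {p q ψ χ : ℝ → ℝ} (hp : MonoLC p) (hq : MonoLC q) (hψ : IsBump ψ)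
    (hχ : IsBump χ)
    (h : ∀ x ∈ Set.Icc (0 : ℝ) 1, ∀ y ∈ Set.Icc (0 : ℝ) 1,
      0 ≤ gap (∫ z in (0 : ℝ)..1, p z) p q x y
        + ((∫ z in (0 : ℝ)..y, χ (q z)) - ∫ z in x..1, ψ (p z))) :
    (fun z => p z + ψ (p z), fun z => q z + χ (q z)) ∈ Mw := by
  rw [mem_Mw_iff]
  refine ⟨hp.add_bump hψ, hq.add_bump hχ, fun x hx y hy => ?_⟩
  have h1 := h x hx y hy
  rw [gap_eq hp hx] at h1
  dsimp only
  rw [gap_eq (hp.add_bump hψ) hx,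
    intervalIntegral.integral_add (hq.intervalIntegrable zero_mem_I hy)
      (hq.intervalIntegrable_bump hχ zero_mem_I hy),
    intervalIntegral.integral_add (hp.intervalIntegrable hx one_mem_I)
      (hp.intervalIntegrable_bump hψ hx one_mem_I)]
  linarith

lemma ExtremePt2.bump_eq_zero {p q ψ χ : ℝ → ℝ} (he : ExtremePt2 Mw (p, q))
    (hψ : IsBump ψ) (hχ : IsBump χ) {ε : ℝ} (hε : 0 < ε)
    (h : ∀ x ∈ Set.Icc (0 : ℝ) 1, ∀ y ∈ Set.Icc (0 : ℝ) 1,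
      ε * |(∫ z in (0 : ℝ)..y, χ (q z)) - ∫ z in x..1, ψ (p z)|
        ≤ gap (∫ z in (0 : ℝ)..1, p z) p q x y) :
    ∀ t ∈ Set.Icc (0 : ℝ) 1, ψ (p t) = 0 ∧ χ (q t) = 0 := by
  obtain ⟨hp, hq, -⟩ := mem_Mw_iff.1 he.1
  set δ := min ε 1 with hδ
  have hδ0 : 0 < δ := lt_min hε one_pos
  have key : ∀ s, |s| = δ →
      (fun z => p z + s * ψ (p z), fun z => q z + s * χ (q z)) ∈ Mw := by
    intro s hs
    have hs1 : |s| ≤ 1 := hs ▸ min_le_right _ _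
    refine add_bump_mem_Mw hp hq (hψ.const_mul hs1) (hχ.const_mul hs1) fun x hx y hy => ?_
    rw [intervalIntegral.integral_const_mul, intervalIntegral.integral_const_mul, ← mul_sub]
    have h1 := h x hx y hy
    have h2 := neg_abs_le (s * ((∫ z in (0 : ℝ)..y, χ (q z)) - ∫ z in x..1, ψ (p z)))
    rw [abs_mul, hs] at h2
    have h3 := mul_le_mul_of_nonneg_right (min_le_left ε 1)
      (abs_nonneg ((∫ z in (0 : ℝ)..y, χ (q z)) - ∫ z in x..1, ψ (p z)))
    linarith
  intro t ht
  have := he.2 _ (key δ (abs_of_pos hδ0)) _ (key (-δ) (by rw [abs_neg, abs_of_pos hδ0]))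
    (1 / 2) (by norm_num) (by norm_num) (fun t _ => ⟨by ring, by ring⟩) t ht
  simp only at this
  constructor
  · have : δ * ψ (p t) = 0 := by linarith [this.1]
    exact (mul_eq_zero.1 this).resolve_left hδ0.ne'
  · have : δ * χ (q t) = 0 := by linarith [this.2]
    exact (mul_eq_zero.1 this).resolve_left hδ0.ne'

lemma integral_eq_zero_of_Ioo {f : ℝ → ℝ} {a b : ℝ} (hab : a ≤ b)
    (h : ∀ z ∈ Set.Ioo a b, f z = 0) : ∫ z in a..b, f z = 0 := by
  rw [intervalIntegral.integral_of_le hab, integral_Ioc_eq_integral_Ioo]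
  exact setIntegral_eq_zero_of_forall_eq_zero h

/-- Where the slack is positive, the first component of an extreme point cannot take four distinct
values. -/
lemma ExtremePt2.not_four_values {p q : ℝ → ℝ} (he : ExtremePt2 Mw (p, q)) {s₁ s₂ s₃ s₄ : ℝ}
    (h₁ : s₁ ∈ Set.Icc (0 : ℝ) 1) (h₂ : s₂ ∈ Set.Icc (0 : ℝ) 1) (h₃ : s₃ ∈ Set.Icc (0 : ℝ) 1)
    (h₄ : s₄ ∈ Set.Icc (0 : ℝ) 1) (h₁₂ : p s₁ < p s₂) (h₂₃ : p s₂ < p s₃) (h₃₄ : p s₃ < p s₄)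
    (hpos : ∀ x ∈ Set.Icc s₁ s₄, ∀ y ∈ Set.Icc (0 : ℝ) 1,
      0 < gap (∫ z in (0 : ℝ)..1, p z) p q x y) : False := by
  obtain ⟨hp, hq, hF⟩ := mem_Mw_iff.1 he.1
  dsimp only at hp hq hF
  have b₁ := isBump_tent (hp.2.1 s₁ h₁).1 (hp.2.1 s₃ h₃).2
  have b₂ := isBump_tent (hp.2.1 s₂ h₂).1 (hp.2.1 s₄ h₄).2
  obtain ⟨α, β, hαβ, hne, h0⟩ : ∃ α β : ℝ, |α| + |β| ≤ 1 ∧ (α ≠ 0 ∨ β ≠ 0) ∧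
      α * (∫ z in (0 : ℝ)..1, tent (p s₁) (p s₃) (p z))
        + β * (∫ z in (0 : ℝ)..1, tent (p s₂) (p s₄) (p z)) = 0 := by
    by_cases hI : ∫ z in (0 : ℝ)..1, tent (p s₁) (p s₃) (p z) = 0
    · exact ⟨1, 0, by simp, Or.inl one_ne_zero, by simp [hI]⟩
    · refine ⟨(∫ z in (0 : ℝ)..1, tent (p s₂) (p s₄) (p z)) / 2,
        -(∫ z in (0 : ℝ)..1, tent (p s₁) (p s₃) (p z)) / 2, ?_, Or.inr ?_, by ring⟩
      · have e1 := hp.abs_integral_bump_le b₁ zero_mem_I one_mem_I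
        have e2 := hp.abs_integral_bump_le b₂ zero_mem_I one_mem_I
        rw [abs_div, abs_div, abs_neg, abs_two]
        linarith
      · simpa using hI
  have hb := b₁.combo b₂ hαβ
  set ψ : ℝ → ℝ := fun v => α * tent (p s₁) (p s₃) v + β * tent (p s₂) (p s₄) v with hψ
  have hlow : ∀ v ≤ p s₁, ψ v = 0 := fun v hv => by
    simp [hψ, tent_eq_zero_of_le hv, tent_eq_zero_of_le (hv.trans h₁₂.le)]
  have hhigh : ∀ v, p s₄ ≤ v → ψ v = 0 := fun v hv => by
    simp [hψ, tent_eq_zero_of_ge hv, tent_eq_zero_of_ge (h₃₄.le.trans hv)]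
  have htot : ∫ z in (0 : ℝ)..1, ψ (p z) = 0 := by
    refine Eq.trans ?_ h0
    rw [← intervalIntegral.integral_const_mul, ← intervalIntegral.integral_const_mul,
      ← intervalIntegral.integral_add
        ((hp.intervalIntegrable_bump b₁ zero_mem_I one_mem_I).const_mul α)
        ((hp.intervalIntegrable_bump b₂ zero_mem_I one_mem_I).const_mul β)]
  obtain ⟨e, he0, hle⟩ := exists_pos_le_gap _ hp hq h₁.1 h₄.2 le_rfl le_rfl hpos
  have hzero := he.bump_eq_zero hb isBump_zero he0 fun x hx y hy => by
    rw [intervalIntegral.integral_zero, zero_sub, abs_neg]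
    by_cases hx4 : s₄ < x
    · rw [integral_eq_zero_of_Ioo hx.2 fun z hz => hhigh _
        (hp.1 h₄ ⟨hx.1.trans hz.1.le, hz.2.le⟩ (hx4.trans hz.1).le)]
      simpa using hF x hx y hy
    by_cases hx1 : x < s₁
    · have e1 := intervalIntegral.integral_add_adjacent_intervals
        (hp.intervalIntegrable_bump hb zero_mem_I hx) (hp.intervalIntegrable_bump hb hx one_mem_I)
      rw [htot, integral_eq_zero_of_Ioo hx.1 fun z hz => hlow _
        (hp.1 ⟨hz.1.le, hz.2.le.trans hx.2⟩ h₁ (hz.2.trans hx1).le), zero_add] at e1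
      rw [e1]
      simpa using hF x hx y hy
    · refine le_trans ?_ (hle x ⟨not_lt.1 hx1, not_lt.1 hx4⟩ y hy)
      exact mul_le_of_le_one_right he0.le (hp.abs_integral_bump_le hb hx one_mem_I)
  have z2 := (hzero s₂ h₂).1
  have z3 := (hzero s₃ h₃).1
  simp only [hψ, tent_eq_zero_of_le le_rfl, tent_eq_zero_of_ge le_rfl, mul_zero, add_zero,
    zero_add, mul_eq_zero, (tent_pos h₁₂ h₂₃).ne', (tent_pos h₂₃ h₃₄).ne', or_false] at z2 z3
  exact hne.elim (fun h => h z2) fun h => h z3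

/-- To the left of all points of zero slack, the first component of an extreme point takes at most
one positive value. -/
lemma ExtremePt2.not_two_values {p q : ℝ → ℝ} (he : ExtremePt2 Mw (p, q)) {s t : ℝ}
    (hs : s ∈ Set.Icc (0 : ℝ) 1) (ht : t ∈ Set.Icc (0 : ℝ) 1) (h0 : 0 < p s) (hst : p s < p t)
    (hpos : ∀ x ∈ Set.Icc 0 t, ∀ y ∈ Set.Icc (0 : ℝ) 1,
      0 < gap (∫ z in (0 : ℝ)..1, p z) p q x y) : False := by
  obtain ⟨hp, hq, hF⟩ := mem_Mw_iff.1 he.1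
  dsimp only at hp hq hF
  have hb := isBump_tent le_rfl (hp.2.1 t ht).2
  obtain ⟨e, he0, hle⟩ := exists_pos_le_gap _ hp hq le_rfl ht.2 le_rfl le_rfl hpos
  have hzero := he.bump_eq_zero hb isBump_zero he0 fun x hx y hy => by
    rw [intervalIntegral.integral_zero, zero_sub, abs_neg]
    by_cases hxt : t < x
    · rw [integral_eq_zero_of_Ioo hx.2 fun z hz => tent_eq_zero_of_ge
        (hp.1 ht ⟨hx.1.trans hz.1.le, hz.2.le⟩ (hxt.trans hz.1).le)]
      simpa using hF x hx y hy
    · refine le_trans ?_ (hle x ⟨hx.1, not_lt.1 hxt⟩ y hy)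
      exact mul_le_of_le_one_right he0.le (hp.abs_integral_bump_le hb hx one_mem_I)
  exact (tent_pos h0 hst).ne' (hzero s hs).1

lemma gap_ge_upper_corner {c : ℝ} {p q : ℝ → ℝ} (hp : MonoLC p) (hq : MonoLC q) {a x y v α : ℝ}
    (ha : a ∈ Set.Icc (0 : ℝ) 1) (hx : x ∈ Set.Icc (0 : ℝ) 1) (hy : y ∈ Set.Icc (0 : ℝ) 1)
    (hv : v ∈ Set.Icc (0 : ℝ) 1) (hax : a ≤ x) (hyv : y ≤ v)
    (h0 : gap c p q a v = 0) (hα : ∀ z ∈ Set.Ioo a x, 1 - v + α ≤ p z)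
    (hyα : v - y ≤ α / 2) (hqa : ∀ z ∈ Set.Ioo y v, q z ≤ 1 - a) :
    (∫ z in a..x, (p z - (1 - v))) + (∫ z in y..v, (1 - a - q z)) ≤ 2 * gap c p q x y := by
  have e1 := gap_sub_left c q hp v ha hx
  have e2 := gap_sub_right c p hq x hy hv
  have e3 : ∫ z in y..v, (q z - (1 - x))
      = (x - a) * (v - y) - ∫ z in y..v, (1 - a - q z) := by
    rw [intervalIntegral.integral_sub (hq.intervalIntegrable hy hv) intervalIntegrable_const,
      intervalIntegral.integral_sub intervalIntegrable_const (hq.intervalIntegrable hy hv)]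
    simp only [intervalIntegral.integral_const, smul_eq_mul]
    ring
  have e4 : α * (x - a) ≤ ∫ z in a..x, (p z - (1 - v)) := by
    calc α * (x - a) = ∫ z in a..x, α := by simp [mul_comm]
      _ ≤ _ := intervalIntegral.integral_mono_on_of_le_Ioo hax intervalIntegrable_const
        (hp.intervalIntegrable_sub _ ha hx) fun z hz => by linarith [hα z hz]
  have e5 : 0 ≤ ∫ z in y..v, (1 - a - q z) := by
    calc (0 : ℝ) = ∫ z in y..v, (0 : ℝ) := by simp
      _ ≤ _ := intervalIntegral.integral_mono_on_of_le_Ioo hyv intervalIntegrable_const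
        (intervalIntegrable_const.sub (hq.intervalIntegrable hy hv))
        fun z hz => sub_nonneg.2 (hqa z hz)
  have e6 : (x - a) * (v - y) ≤ (x - a) * (α / 2) :=
    mul_le_mul_of_nonneg_left hyα (sub_nonneg.2 hax)
  linarith

lemma gap_ge_lower_corner {c : ℝ} {p q : ℝ → ℝ} (hp : MonoLC p) (hq : MonoLC q) {b x y u α : ℝ}
    (hb : b ∈ Set.Icc (0 : ℝ) 1) (hx : x ∈ Set.Icc (0 : ℝ) 1) (hy : y ∈ Set.Icc (0 : ℝ) 1)
    (hu : u ∈ Set.Icc (0 : ℝ) 1) (hxb : x ≤ b) (huy : u ≤ y)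
    (h0 : gap c p q b u = 0) (hα : ∀ z ∈ Set.Ioo x b, p z ≤ 1 - u - α)
    (hyα : y - u ≤ α / 2) (hqb : ∀ z ∈ Set.Ioo u y, 1 - b ≤ q z) :
    (∫ z in x..b, (1 - u - p z)) + (∫ z in u..y, (q z - (1 - b))) ≤ 2 * gap c p q x y := by
  have e1 := gap_sub_left c q hp u hx hb
  have e1' : ∫ z in x..b, (p z - (1 - u)) = - ∫ z in x..b, (1 - u - p z) := by
    rw [← intervalIntegral.integral_neg]
    simp only [neg_sub]
  have e2 := gap_sub_right c p hq x hu hy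
  have e3 : ∫ z in u..y, (q z - (1 - x))
      = (∫ z in u..y, (q z - (1 - b))) - (b - x) * (y - u) := by
    rw [intervalIntegral.integral_sub (hq.intervalIntegrable hu hy) intervalIntegrable_const,
      intervalIntegral.integral_sub (hq.intervalIntegrable hu hy) intervalIntegrable_const]
    simp only [intervalIntegral.integral_const, smul_eq_mul]
    ring
  have e4 : α * (b - x) ≤ ∫ z in x..b, (1 - u - p z) := by
    calc α * (b - x) = ∫ z in x..b, α := by simp [mul_comm]
      _ ≤ _ := intervalIntegral.integral_mono_on_of_le_Ioo hxb intervalIntegrable_const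
        (intervalIntegrable_const.sub (hp.intervalIntegrable hx hb))
        fun z hz => by linarith [hα z hz]
  have e5 : 0 ≤ ∫ z in u..y, (q z - (1 - b)) := by
    calc (0 : ℝ) = ∫ z in u..y, (0 : ℝ) := by simp
      _ ≤ _ := intervalIntegral.integral_mono_on_of_le_Ioo huy intervalIntegrable_const
        (hq.intervalIntegrable_sub _ hu hy)
        fun z hz => sub_nonneg.2 (hqb z hz)
  have e6 : (b - x) * (y - u) ≤ (b - x) * (α / 2) :=
    mul_le_mul_of_nonneg_left hyα (sub_nonneg.2 hxb)
  linarith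

lemma integral_tent_le_left {p : ℝ → ℝ} (hp : MonoLC p) {c d x x' : ℝ} (hc : 0 ≤ c) (hd : d ≤ 1)
    (hx : x ∈ Set.Icc (0 : ℝ) 1) (hx' : x' ∈ Set.Icc (0 : ℝ) 1) (hxx : x ≤ x')
    (h : ∀ z ∈ Set.Ioo x x', c ≤ p z) :
    ∫ z in x..x', tent c d (p z) ≤ ∫ z in x..x', (p z - c) :=
  intervalIntegral.integral_mono_on_of_le_Ioo hxx
    (hp.intervalIntegrable_bump (isBump_tent hc hd) hx hx') (hp.intervalIntegrable_sub _ hx hx')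
    fun z hz => tent_le_left (h z hz)

lemma integral_tent_le_right {p : ℝ → ℝ} (hp : MonoLC p) {c d x x' : ℝ} (hc : 0 ≤ c) (hd : d ≤ 1)
    (hx : x ∈ Set.Icc (0 : ℝ) 1) (hx' : x' ∈ Set.Icc (0 : ℝ) 1) (hxx : x ≤ x')
    (h : ∀ z ∈ Set.Ioo x x', p z ≤ d) :
    ∫ z in x..x', tent c d (p z) ≤ ∫ z in x..x', (d - p z) :=
  intervalIntegral.integral_mono_on_of_le_Ioo hxx
    (hp.intervalIntegrable_bump (isBump_tent hc hd) hx hx')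
    (intervalIntegrable_const.sub (hp.intervalIntegrable hx hx'))
    fun z hz => tent_le_right (h z hz)

lemma integral_tent_nonneg (p : ℝ → ℝ) (c d : ℝ) {x x' : ℝ} (hxx : x ≤ x') :
    0 ≤ ∫ z in x..x', tent c d (p z) :=
  intervalIntegral.integral_nonneg hxx fun _ _ => tent_nonneg _ _ _

lemma integral_tent_le_one {p : ℝ → ℝ} (hp : MonoLC p) {c d x x' : ℝ} (hc : 0 ≤ c) (hd : d ≤ 1)
    (hx : x ∈ Set.Icc (0 : ℝ) 1) (hx' : x' ∈ Set.Icc (0 : ℝ) 1) :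
    ∫ z in x..x', tent c d (p z) ≤ 1 :=
  (abs_le.1 (hp.abs_integral_bump_le (isBump_tent hc hd) hx hx')).2

/-- To the left of all points of zero slack, the first component of an extreme point vanishes as
soon as it stays away from its upper bound. -/
lemma ExtremePt2.eq_zero_of_upper_bound {p q : ℝ → ℝ} (he : ExtremePt2 Mw (p, q)) {k u α : ℝ}
    (hk : k ∈ Set.Icc (0 : ℝ) 1) (hu : u ∈ Set.Icc (0 : ℝ) 1) (hα0 : 0 < α)
    (h0 : gap (∫ z in (0 : ℝ)..1, p z) p q k u = 0) (hα : ∀ z ∈ Set.Ioo 0 k, p z ≤ 1 - u - α)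
    (hpos : ∀ x ∈ Set.Icc 0 k, ∀ y ∈ Set.Ioc u 1,
      0 < gap (∫ z in (0 : ℝ)..1, p z) p q x y) :
    ∀ z ∈ Set.Ioo 0 k, p z = 0 := by
  obtain ⟨hp, hq, hF⟩ := mem_Mw_iff.1 he.1
  dsimp only at hp hq hF
  have hd : 1 - u ≤ 1 := by linarith [hu.1]
  have hb := isBump_tent le_rfl hd
  obtain ⟨e, he0, hle⟩ := exists_pos_le_gap (u := u + α / 2) (v := 1) _ hp hq le_rfl hk.2
    (by linarith [hu.1]) le_rfl fun x hx y hy => hpos x hx y ⟨by linarith [hy.1], hy.2⟩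
  have hpk : ∀ z ∈ Set.Ioo k 1, 1 - u ≤ p z := fun z hz =>
    have hz' : z ∈ Set.Icc (0 : ℝ) 1 := ⟨hk.1.trans hz.1.le, hz.2.le⟩
    ge_of_gap_eq_zero hp hk hz' h0 (hF z hz' u hu) hz.1
  have hzero := he.bump_eq_zero hb isBump_zero (lt_min he0 (by norm_num : (0 : ℝ) < 1 / 2))
    fun x hx y hy => by
    rw [intervalIntegral.integral_zero, zero_sub, abs_neg,
      abs_of_nonneg (integral_tent_nonneg p 0 (1 - u) hx.2)]
    by_cases hxk : k < x
    · rw [integral_eq_zero_of_Ioo hx.2 fun z hz => tent_eq_zero_of_ge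
        (hpk z ⟨hxk.trans hz.1, hz.2⟩)]
      simpa using hF x hx y hy
    rw [not_lt] at hxk
    have hG : ∫ z in x..1, tent 0 (1 - u) (p z) = ∫ z in x..k, tent 0 (1 - u) (p z) := by
      rw [← intervalIntegral.integral_add_adjacent_intervals
        (hp.intervalIntegrable_bump hb hx hk) (hp.intervalIntegrable_bump hb hk one_mem_I),
        integral_eq_zero_of_Ioo hk.2 fun z hz => tent_eq_zero_of_ge (hpk z hz), add_zero]
    have hG0 := integral_tent_nonneg p 0 (1 - u) hx.2
    have hG1 := integral_tent_le_one hp le_rfl hd hx one_mem_I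
    have hGle := integral_tent_le_right hp le_rfl hd hx hk hxk fun z hz => by
      linarith [hα z ⟨hx.1.trans_lt hz.1, hz.2⟩]
    rw [← hG] at hGle
    have hε := mul_le_mul_of_nonneg_right (min_le_left e (1 / 2)) hG0
    have hε' := mul_le_mul_of_nonneg_right (min_le_right e (1 / 2)) hG0
    by_cases hyu : y < u
    · have e1 := gap_sub_left (∫ z in (0 : ℝ)..1, p z) q hp y hx hk
      have e2 : ∫ z in x..k, (1 - u - p z) ≤ - ∫ z in x..k, (p z - (1 - y)) := by
        rw [← intervalIntegral.integral_neg]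
        exact intervalIntegral.integral_mono_on hxk
          (intervalIntegrable_const.sub (hp.intervalIntegrable hx hk))
          (hp.intervalIntegrable_sub _ hx hk).neg fun z _ => by linarith
      linarith [hF k hk y hy]
    rw [not_lt] at hyu
    by_cases hyα : y - u ≤ α / 2
    · have hqk : ∀ z ∈ Set.Ioo u y, 1 - k ≤ q z := fun z hz => by
        have hz' : z ∈ Set.Icc (0 : ℝ) 1 := ⟨hu.1.trans hz.1.le, hz.2.le.trans hy.2⟩
        exact ge_of_gap_eq_zero hq hu hz' (gap_comm _ p q k u ▸ h0)
          (gap_comm _ p q k z ▸ hF k hk z hz') hz.1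
      have e1 := gap_ge_lower_corner hp hq hk hx hy hu hxk hyu h0
        (fun z hz => hα z ⟨hx.1.trans_lt hz.1, hz.2⟩) hyα hqk
      have e2 := intervalIntegral.integral_mono_on_of_le_Ioo hyu intervalIntegrable_const
        (hq.intervalIntegrable_sub (1 - k) hu hy) fun z hz => sub_nonneg.2 (hqk z hz)
      rw [intervalIntegral.integral_zero] at e2
      linarith
    · have := hle x ⟨hx.1, hxk⟩ y ⟨by linarith, hy.2⟩
      have := mul_le_of_le_one_right he0.le hG1
      linarith
  intro z hz
  have hz' : z ∈ Set.Icc (0 : ℝ) 1 := ⟨hz.1.le, hz.2.le.trans hk.2⟩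
  by_contra hne
  exact (tent_pos (lt_of_le_of_ne (hp.2.1 z hz').1 (Ne.symm hne))
    (show p z < 1 - u by linarith [hα z hz])).ne' (hzero z hz').1

lemma abs_mul_sub_mul_le {a b g h s t : ℝ} (ha : 0 ≤ a) (ha1 : a ≤ 1) (hb : 0 ≤ b) (hb1 : b ≤ 1)
    (hg : 0 ≤ g) (hh : 0 ≤ h) (hgs : g ≤ s) (hht : h ≤ t) : |a * g - b * h| ≤ s + t := by
  have h1 := mul_nonneg ha hg
  have h2 := mul_nonneg hb hh
  have h3 := mul_le_of_le_one_left hg ha1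
  have h4 := mul_le_of_le_one_left hh hb1
  rw [abs_le]
  constructor <;> linarith

/-- At an extreme point there is no rectangle `[a, b] × [u, v]` whose corners `(a, v)` and `(b, u)`
have zero slack, such that the slack is positive in between and the first component stays strictly
between its two bounds. -/
lemma ExtremePt2.not_rectangle {p q : ℝ → ℝ} (he : ExtremePt2 Mw (p, q)) {a b u v α : ℝ}
    (ha : a ∈ Set.Icc (0 : ℝ) 1) (hb : b ∈ Set.Icc (0 : ℝ) 1) (hu : u ∈ Set.Icc (0 : ℝ) 1)
    (hv : v ∈ Set.Icc (0 : ℝ) 1) (hab : a < b) (huv : u < v) (hα0 : 0 < α)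
    (hav : gap (∫ z in (0 : ℝ)..1, p z) p q a v = 0)
    (hbu : gap (∫ z in (0 : ℝ)..1, p z) p q b u = 0)
    (hα : ∀ z ∈ Set.Ioo a b, 1 - v + α ≤ p z ∧ p z ≤ 1 - u - α)
    (hpos : ∀ x ∈ Set.Icc a b, ∀ y ∈ Set.Ioo u v,
      0 < gap (∫ z in (0 : ℝ)..1, p z) p q x y) : False := by
  obtain ⟨hp, hq, hF⟩ := mem_Mw_iff.1 he.1
  dsimp only at hp hq hF
  set F := gap (∫ z in (0 : ℝ)..1, p z) p q
  have hF' : ∀ x y, gap (∫ z in (0 : ℝ)..1, p z) q p y x = F x y := fun x y =>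
    (gap_comm _ p q x y).symm
  have hI : ∀ {z}, z ∈ Set.Icc a b → z ∈ Set.Icc (0 : ℝ) 1 := fun hz =>
    ⟨ha.1.trans hz.1, hz.2.trans hb.2⟩
  have hJ : ∀ {z}, z ∈ Set.Icc u v → z ∈ Set.Icc (0 : ℝ) 1 := fun hz =>
    ⟨hu.1.trans hz.1, hz.2.trans hv.2⟩
  have p_low : ∀ z ∈ Set.Icc (0 : ℝ) 1, z < a → p z ≤ 1 - v := fun z hz h =>
    le_of_gap_eq_zero hp ha hz hav (hF z hz v hv) h
  have p_high : ∀ z ∈ Set.Icc (0 : ℝ) 1, b < z → 1 - u ≤ p z := fun z hz h =>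
    ge_of_gap_eq_zero hp hb hz hbu (hF z hz u hu) h
  have q_low : ∀ z ∈ Set.Icc (0 : ℝ) 1, z < u → q z ≤ 1 - b := fun z hz h =>
    le_of_gap_eq_zero hq hu hz ((hF' b u).trans hbu) ((hF' b z).symm ▸ hF b hb z hz) h
  have q_high : ∀ z ∈ Set.Icc (0 : ℝ) 1, v < z → 1 - a ≤ q z := fun z hz h =>
    ge_of_gap_eq_zero hq hv hz ((hF' a v).trans hav) ((hF' a z).symm ▸ hF a ha z hz) h
  have q_mid : ∀ z ∈ Set.Ioo u v, 1 - b < q z ∧ q z < 1 - a := fun z hz =>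
    have hz' := hJ ⟨hz.1.le, hz.2.le⟩
    ⟨lt_of_gap_pos hq hu hz' ((hF' b u).trans hbu)
      ((hF' b z).symm ▸ hpos b ⟨hab.le, le_rfl⟩ z hz) hz.1,
     gt_of_gap_pos hq hv hz' ((hF' a v).trans hav)
      ((hF' a z).symm ▸ hpos a ⟨le_rfl, hab.le⟩ z hz) hz.2⟩
  have hv0 : 0 ≤ 1 - v := sub_nonneg.2 hv.2
  have hu1 : 1 - u ≤ 1 := sub_le_self _ hu.1
  have hb0 : 0 ≤ 1 - b := sub_nonneg.2 hb.2
  have ha1 : 1 - a ≤ 1 := sub_le_self _ ha.1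
  have hT := isBump_tent hv0 hu1
  have hS := isBump_tent hb0 ha1
  set T := tent (1 - v) (1 - u)
  set S := tent (1 - b) (1 - a)
  set I := ∫ z in a..b, T (p z)
  set J := ∫ z in u..v, S (q z)
  have hI0 : 0 < I := intervalIntegral.intervalIntegral_pos_of_pos_on
    (hp.intervalIntegrable_bump hT ha hb) (fun z hz => tent_pos (by linarith [(hα z hz).1])
      (by linarith [(hα z hz).2])) hab
  have hI1 : I ≤ 1 := integral_tent_le_one hp hv0 hu1 ha hb
  have hJ0 : 0 ≤ J := integral_tent_nonneg q _ _ huv.le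
  have hJ1 : J ≤ 1 := integral_tent_le_one hq hb0 ha1 hu hv
  obtain ⟨e, he0, hle⟩ := exists_pos_le_gap (u := u + α / 2) (v := v - α / 2) _ hp hq ha.1 hb.2
    (by linarith [hu.1]) (by linarith [hv.2]) fun x hx y hy =>
      hpos x hx y ⟨by linarith [hy.1], by linarith [hy.2]⟩
  set ε := min (e / 2) (1 / 2)
  have hε0 : 0 < ε := lt_min (by positivity) (by norm_num)
  have hε1 : ε ≤ e / 2 := min_le_left _ _
  have hε2 : ε ≤ 1 / 2 := min_le_right _ _
  set G : ℝ → ℝ := fun x => ∫ z in x..1, T (p z) with hG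
  set H : ℝ → ℝ := fun y => ∫ z in (0 : ℝ)..y, S (q z) with hH
  have G_right : ∀ x ∈ Set.Icc (0 : ℝ) 1, b ≤ x → G x = 0 := fun x hx h =>
    integral_eq_zero_of_Ioo hx.2 fun z hz => tent_eq_zero_of_ge
      (p_high z ⟨hx.1.trans hz.1.le, hz.2.le⟩ (h.trans_lt hz.1))
  have G_mid : ∀ x ∈ Set.Icc a b, G x = ∫ z in x..b, T (p z) := fun x hx => by
    have e1 := intervalIntegral.integral_add_adjacent_intervals
      (hp.intervalIntegrable_bump hT (hI hx) hb) (hp.intervalIntegrable_bump hT hb one_mem_I)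
    have e2 : ∫ z in b..1, T (p z) = 0 := G_right b hb le_rfl
    rw [e2, add_zero] at e1
    exact e1.symm
  have G_left : ∀ x ∈ Set.Icc (0 : ℝ) 1, x ≤ a → G x = G a := fun x hx h => by
    have e1 := intervalIntegral.integral_add_adjacent_intervals
      (hp.intervalIntegrable_bump hT hx ha) (hp.intervalIntegrable_bump hT ha one_mem_I)
    rw [integral_eq_zero_of_Ioo h fun z hz => tent_eq_zero_of_le
      (p_low z ⟨hx.1.trans hz.1.le, hz.2.le.trans ha.2⟩ hz.2), zero_add] at e1
    exact e1.symm
  have G_a : G a = I := G_mid a ⟨le_rfl, hab.le⟩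
  have H_left : ∀ y ∈ Set.Icc (0 : ℝ) 1, y ≤ u → H y = 0 := fun y hy h =>
    integral_eq_zero_of_Ioo hy.1 fun z hz => tent_eq_zero_of_le
      (q_low z ⟨hz.1.le, hz.2.le.trans hy.2⟩ (hz.2.trans_le h))
  have H_mid : ∀ y ∈ Set.Icc u v, H y = ∫ z in u..y, S (q z) := fun y hy => by
    have e1 := intervalIntegral.integral_add_adjacent_intervals
      (hq.intervalIntegrable_bump hS zero_mem_I hu) (hq.intervalIntegrable_bump hS hu (hJ hy))
    have e2 : ∫ z in (0 : ℝ)..u, S (q z) = 0 := H_left u hu le_rfl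
    rw [e2, zero_add] at e1
    exact e1.symm
  have H_right : ∀ y ∈ Set.Icc (0 : ℝ) 1, v ≤ y → H y = H v := fun y hy h => by
    have e1 := intervalIntegral.integral_add_adjacent_intervals
      (hq.intervalIntegrable_bump hS zero_mem_I hv) (hq.intervalIntegrable_bump hS hv hy)
    rw [integral_eq_zero_of_Ioo (f := fun z => S (q z)) h fun z hz => tent_eq_zero_of_ge
      (q_high z ⟨hv.1.trans hz.1.le, hz.2.le.trans hy.2⟩ hz.1), add_zero] at e1
    exact e1.symm
  have H_v : H v = J := H_mid v ⟨huv.le, le_rfl⟩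
  -- the estimate on the rectangle itself
  have inner : ∀ x ∈ Set.Icc a b, ∀ y ∈ Set.Icc u v, ε * |I * H y - J * G x| ≤ F x y := by
    intro x hx y hy
    have hx' := hI hx
    have hy' := hJ hy
    have habs := abs_nonneg (I * H y - J * G x)
    have hε2' := mul_le_mul_of_nonneg_right hε2 habs
    by_cases hyv : v - y ≤ α / 2
    · have c1 := gap_ge_upper_corner hp hq ha hx' hy' hv hx.1 hy.2 hav
        (fun z hz => (hα z ⟨hz.1, hz.2.trans_le hx.2⟩).1) hyv
        (fun z hz => (q_mid z ⟨hy.1.trans_lt hz.1, hz.2⟩).2.le)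
      have c2 := integral_tent_le_left hp hv0 hu1 ha hx' hx.1
        fun z hz => by linarith [(hα z ⟨hz.1, hz.2.trans_le hx.2⟩).1]
      have c3 := integral_tent_le_right hq hb0 ha1 hy' hv hy.2
        fun z hz => (q_mid z ⟨hy.1.trans_lt hz.1, hz.2⟩).2.le
      have e1 := intervalIntegral.integral_add_adjacent_intervals
        (hp.intervalIntegrable_bump hT ha hx') (hp.intervalIntegrable_bump hT hx' hb)
      have e2 := intervalIntegral.integral_add_adjacent_intervals
        (hq.intervalIntegrable_bump hS hu hy') (hq.intervalIntegrable_bump hS hy' hv)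
      rw [← G_mid x hx] at e1
      rw [← H_mid y hy] at e2
      have e3 : I * H y - J * G x
          = J * (∫ z in a..x, T (p z)) - I * (∫ z in y..v, S (q z)) := by
        linear_combination I * e2 - J * e1
      have c4 := abs_mul_sub_mul_le hJ0 hJ1 hI0.le hI1 (integral_tent_nonneg p _ _ hx.1)
        (integral_tent_nonneg q _ _ hy.2) c2 c3
      rw [← e3] at c4
      linarith
    by_cases hyu : y - u ≤ α / 2
    · have c1 := gap_ge_lower_corner hp hq hb hx' hy' hu hx.2 hy.1 hbu
        (fun z hz => (hα z ⟨hx.1.trans_lt hz.1, hz.2⟩).2) hyu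
        (fun z hz => (q_mid z ⟨hz.1, hz.2.trans_le hy.2⟩).1.le)
      have c2 := integral_tent_le_right hp hv0 hu1 hx' hb hx.2
        fun z hz => by linarith [(hα z ⟨hx.1.trans_lt hz.1, hz.2⟩).2]
      have c3 := integral_tent_le_left hq hb0 ha1 hu hy' hy.1
        fun z hz => (q_mid z ⟨hz.1, hz.2.trans_le hy.2⟩).1.le
      have c4 := abs_mul_sub_mul_le hI0.le hI1 hJ0 hJ1 (integral_tent_nonneg q _ _ hy.1)
        (integral_tent_nonneg p _ _ hx.2) c3 c2
      rw [G_mid x hx, H_mid y hy] at hε2' ⊢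
      linarith
    · have c1 := hle x hx y ⟨by linarith, by linarith⟩
      have c4 := abs_mul_sub_mul_le hI0.le hI1 hJ0 hJ1 (integral_tent_nonneg q _ _ hy'.1)
        (integral_tent_nonneg p _ _ hx'.2) (integral_tent_le_one hq hb0 ha1 zero_mem_I hy')
        (integral_tent_le_one hp hv0 hu1 hx' one_mem_I)
      have c5 := mul_le_mul hε1 c4 habs (by positivity)
      linarith
  have strip : ∀ x ∈ Set.Icc a b, ∀ y ∈ Set.Icc (0 : ℝ) 1, ε * |I * H y - J * G x| ≤ F x y := by
    intro x hx y hy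
    rcases lt_or_ge y u with h | h
    · have e1 := gap_sub_right (∫ z in (0 : ℝ)..1, p z) p hq x hy hu
      have e2 := intervalIntegral.integral_mono_on_of_le_Ioo h.le
        (hq.intervalIntegrable_sub (1 - x) hy hu) intervalIntegrable_const fun z hz =>
          sub_nonpos.2 ((q_low z ⟨hy.1.trans hz.1.le, hz.2.le.trans hu.2⟩ hz.2).trans
            (sub_le_sub_left hx.2 1))
      rw [intervalIntegral.integral_zero] at e2
      have := inner x hx u ⟨le_rfl, huv.le⟩
      rw [H_left u hu le_rfl] at this
      rw [H_left y hy h.le]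
      linarith
    rcases lt_or_ge v y with h' | h'
    · have e1 := gap_sub_right (∫ z in (0 : ℝ)..1, p z) p hq x hv hy
      have e2 := intervalIntegral.integral_mono_on_of_le_Ioo h'.le intervalIntegrable_const
        (hq.intervalIntegrable_sub (1 - x) hv hy) fun z hz =>
          sub_nonneg.2 ((sub_le_sub_left hx.1 1).trans
            (q_high z ⟨hv.1.trans hz.1.le, hz.2.le.trans hy.2⟩ hz.1))
      rw [intervalIntegral.integral_zero] at e2
      have := inner x hx v ⟨huv.le, le_rfl⟩
      rw [H_right y hy h'.le]
      linarith
    · exact inner x hx y ⟨h, h'⟩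
  have outer : ∀ x ∈ Set.Icc (0 : ℝ) 1, ∀ y ∈ Set.Icc (0 : ℝ) 1,
      ε * |I * H y - J * G x| ≤ F x y := by
    intro x hx y hy
    rcases lt_or_ge x a with h | h
    · rw [G_left x hx h.le]
      rcases lt_or_ge v y with h' | h'
      · rw [H_right y hy h'.le, H_v, G_a, mul_comm I J, sub_self]
        simpa using hF x hx y hy
      · have e1 := gap_sub_left (∫ z in (0 : ℝ)..1, p z) q hp y hx ha
        have e2 := intervalIntegral.integral_mono_on_of_le_Ioo h.le
          (hp.intervalIntegrable_sub (1 - y) hx ha) intervalIntegrable_const fun z hz =>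
            sub_nonpos.2 ((p_low z ⟨hx.1.trans hz.1.le, hz.2.le.trans ha.2⟩ hz.2).trans
              (sub_le_sub_left h' 1))
        rw [intervalIntegral.integral_zero] at e2
        linarith [strip a ⟨le_rfl, hab.le⟩ y hy]
    rcases lt_or_ge b x with h' | h'
    · rw [G_right x hx h'.le]
      rcases lt_or_ge y u with h'' | h''
      · rw [H_left y hy h''.le]
        simpa using hF x hx y hy
      · have e1 := gap_sub_left (∫ z in (0 : ℝ)..1, p z) q hp y hb hx
        have e2 := intervalIntegral.integral_mono_on_of_le_Ioo h'.le intervalIntegrable_const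
          (hp.intervalIntegrable_sub (1 - y) hb hx) fun z hz =>
            sub_nonneg.2 ((sub_le_sub_left h'' 1).trans
              (p_high z ⟨hb.1.trans hz.1.le, hz.2.le.trans hx.2⟩ hz.1))
        rw [intervalIntegral.integral_zero] at e2
        have := strip b ⟨hab.le, le_rfl⟩ y hy
        rw [G_right b hb le_rfl] at this
        linarith
    · exact strip x ⟨h, h'⟩ y hy
  have hzero := he.bump_eq_zero
    (hT.const_mul (s := J) (by rwa [abs_of_nonneg hJ0]))
    (hS.const_mul (s := I) (by rwa [abs_of_nonneg hI0.le])) hε0 fun x hx y hy => by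
      rw [intervalIntegral.integral_const_mul, intervalIntegral.integral_const_mul]
      exact outer x hx y hy
  have hm : (u + v) / 2 ∈ Set.Ioo u v := ⟨by linarith, by linarith⟩
  have hS0 : 0 < S (q ((u + v) / 2)) := tent_pos (q_mid _ hm).1 (q_mid _ hm).2
  exact (mul_pos hI0 hS0).ne' (hzero _ (hJ ⟨hm.1.le, hm.2.le⟩)).2

lemma exists_lex_min {K : Set (ℝ × ℝ)} (hK : IsCompact K) (hne : K.Nonempty) :
    ∃ z ∈ K, (∀ w ∈ K, z.1 ≤ w.1) ∧ ∀ w ∈ K, w.1 = z.1 → w.2 ≤ z.2 := by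
  obtain ⟨z₀, hz₀, hmin⟩ := hK.exists_isMinOn hne continuous_fst.continuousOn
  have hK' : IsCompact (K ∩ {w | w.1 = z₀.1}) :=
    hK.inter_right (isClosed_eq continuous_fst continuous_const)
  obtain ⟨z, hz, hmax⟩ := hK'.exists_isMaxOn ⟨z₀, hz₀, rfl⟩ continuous_snd.continuousOn
  refine ⟨z, hz.1, fun w hw => ?_, fun w hw h => hmax ⟨hw, h.trans hz.2⟩⟩
  rw [show z.1 = z₀.1 from hz.2]
  exact hmin hw

lemma isCompact_gap_zero (c : ℝ) {p q : ℝ → ℝ} (hp : MonoLC p) (hq : MonoLC q) :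
    IsCompact {z : ℝ × ℝ | z ∈ Set.Icc (0 : ℝ) 1 ×ˢ Set.Icc (0 : ℝ) 1 ∧ gap c p q z.1 z.2 = 0} :=
  (isCompact_Icc.prod isCompact_Icc).of_isClosed_subset
    ((continuousOn_gap c hp hq).preimage_isClosed_of_isClosed
      (isClosed_Icc.prod isClosed_Icc) (isClosed_singleton (x := (0 : ℝ))))
    fun _ hz => hz.1

/-- The first point of zero slack to the right of `s`. -/
lemma exists_first_zero {c : ℝ} {p q : ℝ → ℝ} (hp : MonoLC p) (hq : MonoLC q) {s x₀ y₀ : ℝ}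
    (hx₀ : x₀ ∈ Set.Icc (0 : ℝ) 1) (hy₀ : y₀ ∈ Set.Icc (0 : ℝ) 1) (hs : s ≤ x₀)
    (h0 : gap c p q x₀ y₀ = 0) :
    ∃ b ∈ Set.Icc (0 : ℝ) 1, ∃ u ∈ Set.Icc (0 : ℝ) 1, gap c p q b u = 0 ∧ s ≤ b ∧
      (∀ x ∈ Set.Icc (0 : ℝ) 1, ∀ y ∈ Set.Icc (0 : ℝ) 1, s ≤ x → gap c p q x y = 0 → b ≤ x) ∧
      ∀ y ∈ Set.Icc (0 : ℝ) 1, gap c p q b y = 0 → y ≤ u := by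
  obtain ⟨z, hz, h1, h2⟩ := exists_lex_min ((isCompact_gap_zero c hp hq).inter_right
    (isClosed_le (continuous_const (y := s)) continuous_fst)) ⟨(x₀, y₀), ⟨⟨hx₀, hy₀⟩, h0⟩, hs⟩
  exact ⟨z.1, hz.1.1.1, z.2, hz.1.1.2, hz.1.2, hz.2,
    fun x hx y hy hsx h => h1 (x, y) ⟨⟨⟨hx, hy⟩, h⟩, hsx⟩,
    fun y hy h => h2 (z.1, y) ⟨⟨⟨hz.1.1.1, hy⟩, h⟩, hz.2⟩ rfl⟩

/-- The last point of zero slack to the left of `s`. -/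
lemma exists_last_zero {c : ℝ} {p q : ℝ → ℝ} (hp : MonoLC p) (hq : MonoLC q) {s x₀ y₀ : ℝ}
    (hx₀ : x₀ ∈ Set.Icc (0 : ℝ) 1) (hy₀ : y₀ ∈ Set.Icc (0 : ℝ) 1) (hs : x₀ ≤ s)
    (h0 : gap c p q x₀ y₀ = 0) :
    ∃ a ∈ Set.Icc (0 : ℝ) 1, ∃ v ∈ Set.Icc (0 : ℝ) 1, gap c p q a v = 0 ∧ a ≤ s ∧
      (∀ x ∈ Set.Icc (0 : ℝ) 1, ∀ y ∈ Set.Icc (0 : ℝ) 1, x ≤ s → gap c p q x y = 0 → x ≤ a) ∧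
      ∀ y ∈ Set.Icc (0 : ℝ) 1, gap c p q a y = 0 → v ≤ y := by
  have hK := ((isCompact_gap_zero c hp hq).inter_right
    (isClosed_le continuous_fst (continuous_const (y := s)))).neg
  obtain ⟨z, hz, h1, h2⟩ := exists_lex_min hK ⟨-(x₀, y₀), by
    rw [Set.neg_mem_neg]; exact ⟨⟨⟨hx₀, hy₀⟩, h0⟩, hs⟩⟩
  refine ⟨-z.1, hz.1.1.1, -z.2, hz.1.1.2, hz.1.2, hz.2, fun x hx y hy hsx h => ?_,
    fun y hy h => ?_⟩
  · have := h1 (-(x, y)) (by rw [Set.neg_mem_neg]; exact ⟨⟨⟨hx, hy⟩, h⟩, hsx⟩)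
    simp only [Prod.fst_neg] at this
    linarith
  · have := h2 (-(-z.1, y)) (by rw [Set.neg_mem_neg]; exact ⟨⟨⟨hz.1.1.1, hy⟩, h⟩, hz.2⟩)
      (by simp)
    simp only [Prod.snd_neg] at this
    linarith

/-- Points of zero slack of an extreme point leave no gap in the first coordinate. -/
lemma ExtremePt2.exists_zero_of_between {p q : ℝ → ℝ} (he : ExtremePt2 Mw (p, q))
    {x₀ y₀ x₁ y₁ s : ℝ} (hx₀ : x₀ ∈ Set.Icc (0 : ℝ) 1) (hy₀ : y₀ ∈ Set.Icc (0 : ℝ) 1)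
    (hx₁ : x₁ ∈ Set.Icc (0 : ℝ) 1) (hy₁ : y₁ ∈ Set.Icc (0 : ℝ) 1)
    (h₀ : gap (∫ z in (0 : ℝ)..1, p z) p q x₀ y₀ = 0)
    (h₁ : gap (∫ z in (0 : ℝ)..1, p z) p q x₁ y₁ = 0) (hs₀ : x₀ ≤ s) (hs₁ : s ≤ x₁) :
    ∃ y ∈ Set.Icc (0 : ℝ) 1, gap (∫ z in (0 : ℝ)..1, p z) p q s y = 0 := by
  obtain ⟨hp, hq, hF⟩ := mem_Mw_iff.1 he.1
  dsimp only at hp hq hF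
  by_contra! hno
  obtain ⟨a, ha, v, hv, hav, has, ha_max, hv_min⟩ := exists_last_zero hp hq hx₀ hy₀ hs₀ h₀
  obtain ⟨b, hb, u, hu, hbu, hsb, hb_min, hu_max⟩ := exists_first_zero hp hq hx₁ hy₁ hs₁ h₁
  replace has : a < s := lt_of_le_of_ne has fun h => hno v hv (h ▸ hav)
  replace hsb : s < b := lt_of_le_of_ne hsb fun h => hno u hu (h ▸ hbu)
  have hab := has.trans hsb
  have hI : ∀ {z}, z ∈ Set.Ioo a b → z ∈ Set.Icc (0 : ℝ) 1 := fun hz =>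
    ⟨ha.1.trans hz.1.le, hz.2.le.trans hb.2⟩
  have hposx : ∀ x ∈ Set.Ioo a b, ∀ y ∈ Set.Icc (0 : ℝ) 1,
      0 < gap (∫ z in (0 : ℝ)..1, p z) p q x y := fun x hx y hy => by
    refine lt_of_le_of_ne (hF x (hI hx) y hy) fun h => ?_
    rcases le_total x s with hxs | hxs
    · exact absurd (ha_max x (hI hx) y hy hxs h.symm) (not_le.2 hx.1)
    · exact absurd (hb_min x (hI hx) y hy hxs h.symm) (not_le.2 hx.2)
  have p_low : ∀ x ∈ Set.Ioo a b, 1 - v < p x := fun x hx =>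
    lt_of_gap_pos hp ha (hI hx) hav (hposx x hx v hv) hx.1
  have p_high : ∀ x ∈ Set.Ioo a b, p x < 1 - u := fun x hx =>
    gt_of_gap_pos hp hb (hI hx) hbu (hposx x hx u hu) hx.2
  have huv : u < v := by linarith [p_low s ⟨has, hsb⟩, p_high s ⟨has, hsb⟩]
  have hposy : ∀ x ∈ Set.Icc a b, ∀ y ∈ Set.Ioo u v,
      0 < gap (∫ z in (0 : ℝ)..1, p z) p q x y := fun x hx y hy => by
    have hy' : y ∈ Set.Icc (0 : ℝ) 1 := ⟨hu.1.trans hy.1.le, hy.2.le.trans hv.2⟩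
    rcases eq_or_lt_of_le hx.1 with rfl | hax
    · exact lt_of_le_of_ne (hF _ ha y hy') fun h =>
        absurd (hv_min y hy' h.symm) (not_le.2 hy.2)
    rcases eq_or_lt_of_le hx.2 with rfl | hxb
    · exact lt_of_le_of_ne (hF _ hb y hy') fun h =>
        absurd (hu_max y hy' h.symm) (not_le.2 hy.1)
    · exact hposx x ⟨hax, hxb⟩ y hy'
  have hfour : ∀ s₁ ∈ Set.Ioo a b, ∀ s₂ ∈ Set.Ioo a b, ∀ s₃ ∈ Set.Ioo a b, ∀ s₄ ∈ Set.Ioo a b,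
      p s₁ < p s₂ → p s₂ < p s₃ → p s₃ < p s₄ → False :=
    fun s₁ h₁ s₂ h₂ s₃ h₃ s₄ h₄ h₁₂ h₂₃ h₃₄ =>
      he.not_four_values (hI h₁) (hI h₂) (hI h₃) (hI h₄) h₁₂ h₂₃ h₃₄ fun x hx =>
        hposx x ⟨h₁.1.trans_le hx.1, hx.2.trans_lt h₄.2⟩
  obtain ⟨α, hα0, hα⟩ : ∃ α, 0 < α ∧ ∀ x ∈ Set.Ioo a b, 1 - v + α ≤ p x := by
    by_contra! h
    have hstep : ∀ t ∈ Set.Ioo a b, ∃ t' ∈ Set.Ioo a b, p t' < p t := fun t ht => by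
      obtain ⟨t', ht', h'⟩ := h (p t - (1 - v)) (sub_pos.2 (p_low t ht))
      exact ⟨t', ht', by linarith⟩
    obtain ⟨s₃, h₃, h₃₄⟩ := hstep s ⟨has, hsb⟩
    obtain ⟨s₂, h₂, h₂₃⟩ := hstep s₃ h₃
    obtain ⟨s₁, h₁, h₁₂⟩ := hstep s₂ h₂
    exact hfour s₁ h₁ s₂ h₂ s₃ h₃ s ⟨has, hsb⟩ h₁₂ h₂₃ h₃₄
  obtain ⟨β, hβ0, hβ⟩ : ∃ β, 0 < β ∧ ∀ x ∈ Set.Ioo a b, p x ≤ 1 - u - β := by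
    by_contra! h
    have hstep : ∀ t ∈ Set.Ioo a b, ∃ t' ∈ Set.Ioo a b, p t < p t' := fun t ht => by
      obtain ⟨t', ht', h'⟩ := h (1 - u - p t) (sub_pos.2 (p_high t ht))
      exact ⟨t', ht', by linarith⟩
    obtain ⟨s₂, h₂, h₁₂⟩ := hstep s ⟨has, hsb⟩
    obtain ⟨s₃, h₃, h₂₃⟩ := hstep s₂ h₂
    obtain ⟨s₄, h₄, h₃₄⟩ := hstep s₃ h₃
    exact hfour s ⟨has, hsb⟩ s₂ h₂ s₃ h₃ s₄ h₄ h₁₂ h₂₃ h₃₄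
  exact he.not_rectangle ha hb hu hv hab huv (lt_min hα0 hβ0) hav hbu
    (fun z hz => ⟨by linarith [hα z hz, min_le_left α β], by linarith [hβ z hz, min_le_right α β]⟩)
    hposy

/-- To the left of the first point of zero slack, the first component of an extreme point
vanishes. -/
lemma ExtremePt2.eq_zero_of_lt_first_zero {p q : ℝ → ℝ} (he : ExtremePt2 Mw (p, q)) {k u : ℝ}
    (hk : k ∈ Set.Icc (0 : ℝ) 1) (hu : u ∈ Set.Icc (0 : ℝ) 1)
    (h0 : gap (∫ z in (0 : ℝ)..1, p z) p q k u = 0)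
    (hmin : ∀ x ∈ Set.Icc (0 : ℝ) 1, ∀ y ∈ Set.Icc (0 : ℝ) 1,
      gap (∫ z in (0 : ℝ)..1, p z) p q x y = 0 → k ≤ x)
    (hmax : ∀ y ∈ Set.Icc (0 : ℝ) 1, gap (∫ z in (0 : ℝ)..1, p z) p q k y = 0 → y ≤ u) :
    ∀ z ∈ Set.Ioo 0 k, p z = 0 := by
  obtain ⟨hp, hq, hF⟩ := mem_Mw_iff.1 he.1
  dsimp only at hp hq hF
  have hI : ∀ {z}, z ∈ Set.Ioo 0 k → z ∈ Set.Icc (0 : ℝ) 1 := fun hz =>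
    ⟨hz.1.le, hz.2.le.trans hk.2⟩
  have hpos : ∀ x ∈ Set.Ico 0 k, ∀ y ∈ Set.Icc (0 : ℝ) 1,
      0 < gap (∫ z in (0 : ℝ)..1, p z) p q x y := fun x hx y hy =>
    have hx' : x ∈ Set.Icc (0 : ℝ) 1 := ⟨hx.1, hx.2.le.trans hk.2⟩
    lt_of_le_of_ne (hF x hx' y hy) fun h => absurd (hmin x hx' y hy h.symm) (not_le.2 hx.2)
  have p_high : ∀ x ∈ Set.Ioo 0 k, p x < 1 - u := fun x hx =>
    gt_of_gap_pos hp hk (hI hx) h0 (hpos x ⟨hx.1.le, hx.2⟩ u hu) hx.2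
  by_contra! hex
  obtain ⟨s, hs, hps⟩ := hex
  have hps0 : 0 < p s := lt_of_le_of_ne (hp.2.1 s (hI hs)).1 (Ne.symm hps)
  obtain ⟨α, hα0, hα⟩ : ∃ α, 0 < α ∧ ∀ x ∈ Set.Ioo 0 k, p x ≤ 1 - u - α := by
    by_contra! h
    obtain ⟨t, ht, h'⟩ := h (1 - u - p s) (sub_pos.2 (p_high s hs))
    exact he.not_two_values (hI hs) (hI ht) hps0 (by linarith)
      fun x hx => hpos x ⟨hx.1, hx.2.trans_lt ht.2⟩
  refine hps (he.eq_zero_of_upper_bound hk hu hα0 h0 hα (fun x hx y hy => ?_) s hs)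
  have hy' : y ∈ Set.Icc (0 : ℝ) 1 := ⟨hu.1.trans hy.1.le, hy.2⟩
  rcases eq_or_lt_of_le hx.2 with rfl | hxk
  · exact lt_of_le_of_ne (hF _ hk y hy') fun h => absurd (hmax y hy' h.symm) (not_le.2 hy.1)
  · exact hpos x ⟨hx.1, hxk⟩ y hy'

lemma ae_eq_of_integral_right_eq {f g : ℝ → ℝ} {k : ℝ} (hk : k ≤ 1)
    (hf : IntervalIntegrable f volume k 1) (hg : IntervalIntegrable g volume k 1)
    (h : ∀ x ∈ Set.Icc k 1, ∫ z in x..1, f z = ∫ z in x..1, g z) :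
    ∀ᵐ z, z ∈ Set.Ioo k 1 → f z = g z := by
  filter_upwards [hf.ae_hasDerivAt_integral, hg.ae_hasDerivAt_integral] with z hfz hgz hz
  rw [Set.uIcc_of_le hk] at hfz hgz
  have hz' := Set.Ioo_subset_Icc_self hz
  have h1 : (1 : ℝ) ∈ Set.Icc k 1 := ⟨hk, le_rfl⟩
  refine (hfz hz' 1 h1).unique ((hgz hz' 1 h1).congr_of_eventuallyEq ?_)
  filter_upwards [Ioo_mem_nhds hz.1 hz.2] with x hx
  rw [intervalIntegral.integral_symm, h x (Set.Ioo_subset_Icc_self hx),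
    ← intervalIntegral.integral_symm]

/-- `𝕄ʷ` is convex, and every extreme point `q` of `𝕄ʷ` satisfies
`q₁ = q̂₂ · 1_{[k,1]}` (a.e. on `[0,1]`) for some `k ∈ [0,1]`. -/
theorem stmt15 :
    Convex ℝ Mw ∧
    ∀ q, ExtremePt2 Mw q →
      ∃ k ∈ Set.Icc (0 : ℝ) 1,
        ∀ᵐ z ∂(volume.restrict (Set.Icc (0 : ℝ) 1)),
          (k ≤ z → q.1 z = conj q.2 z) ∧ (z < k → q.1 z = 0) := by
  refine ⟨convex_Mw, ?_⟩
  rintro ⟨p, q⟩ he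
  have hmem := he.1
  obtain ⟨hp, hq, hF⟩ := mem_Mw_iff.1 he.1
  dsimp only at hp hq hF ⊢
  have h10 : gap (∫ z in (0 : ℝ)..1, p z) p q 1 0 = 0 := by simp [gap]
  obtain ⟨k, hk, u, hu, hku, -, hmin, hmax⟩ :=
    exists_first_zero hp hq one_mem_I zero_mem_I zero_le_one h10
  refine ⟨k, hk, ?_⟩
  have hint : ∀ x ∈ Set.Icc k 1, ∫ z in x..1, p z = ∫ z in x..1, conj q z := by
    intro x hx
    have hx' : x ∈ Set.Icc (0 : ℝ) 1 := ⟨hk.1.trans hx.1, hx.2⟩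
    obtain ⟨y, hy, hxy⟩ :=
      he.exists_zero_of_between hk hu one_mem_I zero_mem_I hku h10 hx.1 hx.2
    refine le_antisymm (hmem.2.2 x hx') ?_
    rw [gap_eq hp hx'] at hxy
    rw [integral_conj_eq hq hx.2]
    linarith [integral_min_le hq (1 - x) hy]
  have hae := ae_eq_of_integral_right_eq hk.2 (hp.intervalIntegrable hk one_mem_I)
    (conj_intervalIntegrable q k 1) hint
  have hzero := he.eq_zero_of_lt_first_zero hk hu hku
    (fun x hx y hy => hmin x hx y hy hx.1) hmax
  have hne : ∀ a : ℝ, ∀ᵐ z : ℝ, z ≠ a := fun a => by simp [ae_iff, measure_singleton]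
  rw [ae_restrict_iff' measurableSet_Icc]
  filter_upwards [hae, hne 0, hne 1, hne k] with z hz hz0 hz1 hzk hzI
  exact ⟨fun h => hz ⟨lt_of_le_of_ne h hzk.symm, lt_of_le_of_ne hzI.2 hz1⟩,
    fun h => hzero z ⟨lt_of_le_of_ne hzI.1 hz0.symm, h⟩⟩
end
end

section
/- A tuple q = (q_1,…,q_n) of nondecreasing left-continuous functions q_i : [0,1] → [0,1] is rationalizable if and only if it is rationalized by some monotone function f : [0,1]^n → [0,1], i.e., a function satisfying f(x) ≤ f(y) whenever x ≤ y componentwise. -/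
open MeasureTheory

noncomputable section

/-- The closed unit cube `[0,1]^n` in `ℝⁿ`. -/
def cube (n : ℕ) : Set (Fin n → ℝ) := Set.Icc 0 1

/-- `f : [0,1]^n → [0,1]` rationalizes the tuple `q`: for each `i`, `q i` is (a.e.) the
one-dimensional marginal of `f` in dimension `i`. -/
def RationalizesN (n : ℕ) (f : (Fin n → ℝ) → ℝ) (q : Fin n → ℝ → ℝ) : Prop :=
  AEMeasurable f (volume.restrict (cube n)) ∧
  (∀ x ∈ cube n, f x ∈ Set.Icc (0 : ℝ) 1) ∧
  ∀ i, ∀ᵐ t ∂(volume.restrict (Set.Icc (0 : ℝ) 1)),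
    q i t = ∫ x in cube n, f (Function.update x i t)

lemma integrable_of_mem_unitInterval {α : Type*} [MeasurableSpace α] {μ : Measure α}
    [IsFiniteMeasure μ] {f : α → ℝ} (hf : Measurable f) (h : ∀ x, f x ∈ Set.Icc (0 : ℝ) 1) :
    Integrable f μ :=
  Integrable.of_bound hf.aestronglyMeasurable 1 <| .of_forall fun x => by
    rw [Real.norm_eq_abs, abs_le]
    exact ⟨by linarith [(h x).1], (h x).2⟩

/-- Among the `[0,1]`-valued functions with the same integrals as `f₀` over the sets of `𝒮`, there
is one that satisfies the variational inequality of the element of least `L²` norm. -/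
lemma exists_least_norm {α : Type*} [MeasurableSpace α] (μ : Measure α)
    [IsFiniteMeasure μ] (𝒮 : Set (Set α)) (h𝒮 : ∀ s ∈ 𝒮, MeasurableSet s) {f₀ : α → ℝ}
    (hf₀ : Measurable f₀) (hf₀' : ∀ x, f₀ x ∈ Set.Icc (0 : ℝ) 1) :
    ∃ f : α → ℝ, Measurable f ∧ (∀ x, f x ∈ Set.Icc (0 : ℝ) 1) ∧
      (∀ s ∈ 𝒮, ∫ x in s, f x ∂μ = ∫ x in s, f₀ x ∂μ) ∧
      ∀ h : α → ℝ, Measurable h → (∀ x, h x ∈ Set.Icc (0 : ℝ) 1) →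
        (∀ s ∈ 𝒮, ∫ x in s, h x ∂μ = ∫ x in s, f₀ x ∂μ) → 0 ≤ ∫ x, f x * (h x - f x) ∂μ := by
  have memLp : ∀ {g : α → ℝ}, Measurable g → (∀ x, g x ∈ Set.Icc (0 : ℝ) 1) → MemLp g 2 μ := by
    intro g hg hg'
    refine MemLp.of_bound hg.aestronglyMeasurable 1 (.of_forall fun x => ?_)
    rw [Real.norm_eq_abs, abs_le]
    exact ⟨by linarith [(hg' x).1], (hg' x).2⟩
  let one : Lp ℝ 2 μ := (memLp (g := fun _ => 1) measurable_const (by simp)).toLp _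
  have one_ae : one =ᵐ[μ] fun _ => 1 := MemLp.coeFn_toLp _
  have inner_set : ∀ s (hs : MeasurableSet s) (g : Lp ℝ 2 μ),
      inner ℝ (indicatorConstLp 2 hs (measure_ne_top μ s) (1 : ℝ)) g = ∫ x in s, g x ∂μ :=
    fun s hs g => L2.inner_indicatorConstLp_one (𝕜 := ℝ) hs (measure_ne_top μ s) g
  let K : Set (Lp ℝ 2 μ) := Set.Icc 0 one ∩
    ⋂ s : 𝒮, {g | inner ℝ (indicatorConstLp 2 (h𝒮 s s.2) (measure_ne_top μ s) (1 : ℝ)) g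
      = ∫ x in (s : Set α), f₀ x ∂μ}
  have hKc : IsClosed K := by
    refine isClosed_Icc.inter (isClosed_iInter fun s => ?_)
    exact isClosed_eq (by fun_prop) continuous_const
  have hKconv : Convex ℝ K := by
    have : Convex ℝ (Set.Icc 0 one) := by
      rintro x ⟨hx0, hx1⟩ y ⟨hy0, hy1⟩ a b ha hb hab
      rw [← Lp.coeFn_nonneg] at hx0 hy0
      rw [← Lp.coeFn_le] at hx1 hy1
      rw [Set.mem_Icc, ← Lp.coeFn_nonneg, ← Lp.coeFn_le]
      have e : (a • x + b • y : Lp ℝ 2 μ) =ᵐ[μ] fun z => a * x z + b * y z := by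
        filter_upwards [Lp.coeFn_add (a • x) (b • y), Lp.coeFn_smul a x, Lp.coeFn_smul b y]
          with z h1 h2 h3
        rw [h1, Pi.add_apply, h2, h3]
        rfl
      constructor
      · filter_upwards [e, hx0, hy0] with z h1 h2 h3
        rw [h1]
        exact add_nonneg (mul_nonneg ha h2) (mul_nonneg hb h3)
      · filter_upwards [e, hx1, hy1] with z h1 h2 h3
        rw [h1]
        calc a * x z + b * y z ≤ a * one z + b * one z := by gcongr
          _ = one z := by rw [← add_mul, hab, one_mul]
    refine this.inter (convex_iInter fun s => ?_)
    intro x hx y hy a b _ _ hab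
    simp only [Set.mem_ofPred_eq] at hx hy ⊢
    rw [inner_add_right, real_inner_smul_right, real_inner_smul_right, hx, hy, ← add_mul, hab,
      one_mul]
  have mem_K : ∀ {g : α → ℝ} (hg : Measurable g) (hg' : ∀ x, g x ∈ Set.Icc (0 : ℝ) 1),
      (∀ s ∈ 𝒮, ∫ x in s, g x ∂μ = ∫ x in s, f₀ x ∂μ) → (memLp hg hg').toLp g ∈ K := by
    intro g hg hg' hgs
    have e := (memLp hg hg').coeFn_toLp
    refine ⟨⟨?_, ?_⟩, Set.mem_iInter.2 fun s => ?_⟩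
    · rw [← Lp.coeFn_nonneg]
      filter_upwards [e] with x hx
      rw [hx]; exact (hg' x).1
    · rw [← Lp.coeFn_le]
      filter_upwards [e, one_ae] with x hx h1
      rw [hx, h1]; exact (hg' x).2
    · rw [Set.mem_ofPred_eq, inner_set, ← hgs s s.2]
      exact integral_congr_ae (ae_restrict_of_ae e)
  obtain ⟨u, huK, hu⟩ := exists_norm_eq_iInf_of_complete_convex ⟨_, mem_K hf₀ hf₀' fun _ _ => rfl⟩
    hKc.isComplete hKconv 0
  rw [norm_eq_iInf_iff_real_inner_le_zero hKconv huK] at hu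
  have hum := Lp.stronglyMeasurable u
  refine ⟨fun x => max 0 (min 1 (u x)), by have := hum.measurable; fun_prop,
    fun x => ⟨by simp, by simp⟩, ?_⟩
  have hfu : (fun x => max 0 (min 1 (u x))) =ᵐ[μ] u := by
    filter_upwards [(Lp.coeFn_nonneg _).2 huK.1.1, (Lp.coeFn_le _ _).2 huK.1.2, one_ae]
      with x h0 h1 h2
    rw [h2] at h1
    simp only [Pi.zero_apply] at h0
    rw [min_eq_right h1, max_eq_right h0]
  refine ⟨fun s hs => ?_, fun h hm h01 hs => ?_⟩
  · rw [integral_congr_ae (ae_restrict_of_ae hfu), ← inner_set s (h𝒮 s hs)]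
    exact Set.mem_iInter.1 huK.2 ⟨s, hs⟩
  · have := hu _ (mem_K hm h01 hs)
    rw [zero_sub, inner_neg_left, neg_nonpos, L2.inner_def] at this
    refine this.trans_eq (integral_congr_ae ?_)
    filter_upwards [hfu, (memLp hm h01).coeFn_toLp, Lp.coeFn_sub ((memLp hm h01).toLp h) u]
      with x h1 h2 h3
    rw [h3, Pi.sub_apply, h2, h1]
    simp [mul_comm]

/-- A bounded function on `ℝ^ι` that increases almost everywhere under every nonnegative
translation agrees almost everywhere with a monotone function. -/
lemma exists_monotone_ae_eq {ι : Type*} [Fintype ι] {f : (ι → ℝ) → ℝ} (hf : Measurable f)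
    (hf01 : ∀ x, f x ∈ Set.Icc (0 : ℝ) 1) (hmono : ∀ v, 0 ≤ v → ∀ᵐ x, f x ≤ f (x + v)) :
    ∃ F : (ι → ℝ) → ℝ, Monotone F ∧ (∀ x, F x ∈ Set.Icc (0 : ℝ) 1) ∧ F =ᵐ[volume] f := by
  let A : ℕ → (ι → ℝ) → ℝ := fun k x =>
    ⨍ y in Metric.closedBall x (1 / ((k : ℝ) + 1)), f y
  have hA : ∀ k x, A k x = ⨍ y in Metric.closedBall (0 : ι → ℝ) (1 / ((k : ℝ) + 1)), f (y + x) := by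
    intro k x
    have mp := measurePreserving_add_right (volume : Measure (ι → ℝ)) x
    have := mp.setIntegral_preimage_emb (MeasurableEquiv.addRight x).measurableEmbedding f
      (Metric.closedBall x (1 / ((k : ℝ) + 1)))
    have pre : (fun y => y + x) ⁻¹' Metric.closedBall x (1 / ((k : ℝ) + 1))
        = Metric.closedBall 0 (1 / ((k : ℝ) + 1)) := by
      ext y; simp [dist_eq_norm]
    rw [pre] at this
    simp only [A, setAverage_eq, this]
    congr 2
    rw [measureReal_def, measureReal_def, ← pre, mp.measure_preimage
      Metric.isClosed_closedBall.measurableSet.nullMeasurableSet]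
  have fin : ∀ k : ℕ, IsFiniteMeasure
      (volume.restrict (Metric.closedBall (0 : ι → ℝ) (1 / ((k : ℝ) + 1)))) := fun k =>
    ⟨by rw [Measure.restrict_apply_univ]; exact measure_closedBall_lt_top⟩
  have int : ∀ (k : ℕ) x, Integrable (fun y => f (y + x))
      (volume.restrict (Metric.closedBall (0 : ι → ℝ) (1 / ((k : ℝ) + 1)))) := fun k x =>
    integrable_of_mem_unitInterval (by fun_prop) fun y => hf01 _
  have hA01 : ∀ k x, A k x ∈ Set.Icc (0 : ℝ) 1 := by
    intro k x
    have pos : 0 < volume (Metric.closedBall (0 : ι → ℝ) (1 / ((k : ℝ) + 1))) :=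
      Metric.measure_closedBall_pos _ _ (by positivity)
    rw [hA]
    exact (convex_Icc (0 : ℝ) 1).set_average_mem isClosed_Icc pos.ne'
      measure_closedBall_lt_top.ne (.of_forall fun y => hf01 _) (int k x)
  have hAmono : ∀ k, Monotone (A k) := by
    intro k x y hxy
    rw [hA, hA, setAverage_eq, setAverage_eq]
    refine smul_le_smul_of_nonneg_left ?_ (by positivity)
    refine integral_mono_ae (int k x) (int k y) (ae_restrict_of_ae ?_)
    have := hmono (y - x) (sub_nonneg.2 hxy)
    filter_upwards [(measurePreserving_add_right volume x).quasiMeasurePreserving.ae this] with z hz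
    rwa [add_assoc, add_sub_cancel] at hz
  have bdd : ∀ x, Filter.IsBoundedUnder (· ≤ ·) Filter.atTop fun k => A k x := fun x =>
    Filter.isBoundedUnder_of ⟨1, fun k => (hA01 k x).2⟩
  have bdd' : ∀ x, Filter.IsBoundedUnder (· ≥ ·) Filter.atTop fun k => A k x := fun x =>
    Filter.isBoundedUnder_of ⟨0, fun k => (hA01 k x).1⟩
  refine ⟨fun x => Filter.limsup (fun k => A k x) Filter.atTop, fun x y hxy => ?_,
    fun x => ⟨?_, ?_⟩, ?_⟩
  · exact Filter.limsup_le_limsup (.of_forall fun k => hAmono k hxy)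
      (bdd' x).isCoboundedUnder_le (bdd y)
  · exact Filter.le_limsup_of_frequently_le (.of_forall fun k => (hA01 k x).1) (bdd x)
  · exact Filter.limsup_le_of_le (bdd' x).isCoboundedUnder_le (.of_forall fun k => (hA01 k x).2)
  · have loc : LocallyIntegrable f (volume : Measure (ι → ℝ)) := by
      rw [locallyIntegrable_iff]
      intro k hk
      have : IsFiniteMeasure (volume.restrict k) :=
        ⟨by rw [Measure.restrict_apply_univ]; exact hk.measure_lt_top⟩
      exact integrable_of_mem_unitInterval hf hf01
    filter_upwards [IsUnifLocDoublingMeasure.ae_tendsto_average volume loc 1] with x hx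
    refine (hx (l := Filter.atTop) (fun _ : ℕ => x) (fun k : ℕ => 1 / ((k : ℝ) + 1)) ?_
      (.of_forall fun k => Metric.mem_closedBall_self (by positivity))).limsup_eq
    exact tendsto_nhdsWithin_iff.2 ⟨tendsto_one_div_add_atTop_nhds_zero_nat,
      .of_forall fun k => Set.mem_Ioi.2 (by positivity)⟩

instance : IsProbabilityMeasure (volume.restrict (Set.Icc (0 : ℝ) 1)) :=
  ⟨by simp⟩

lemma restrict_cube_eq_pi (n : ℕ) :
    (volume.restrict (cube n) : Measure (Fin n → ℝ))
      = Measure.pi fun _ => volume.restrict (Set.Icc (0 : ℝ) 1) := by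
  rw [volume_pi, ← Measure.restrict_pi_pi, Set.pi_univ_Icc]
  rfl

instance (n : ℕ) : IsProbabilityMeasure (volume.restrict (cube n)) := by
  rw [restrict_cube_eq_pi]
  infer_instance

/-- Resampling one coordinate of a uniform point of the cube gives a uniform point. -/
lemma measurePreserving_update {n : ℕ} (i : Fin n) :
    MeasurePreserving (fun p : ℝ × (Fin n → ℝ) => Function.update p.2 i p.1)
      ((volume.restrict (Set.Icc (0 : ℝ) 1)).prod (volume.restrict (cube n)))
      (volume.restrict (cube n)) := by
  have hm : Measurable fun p : ℝ × (Fin n → ℝ) => Function.update p.2 i p.1 :=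
    measurable_update'.comp (by fun_prop : Measurable fun p : ℝ × (Fin n → ℝ) => (p.2, p.1))
  refine ⟨hm, ?_⟩
  conv_rhs => rw [restrict_cube_eq_pi]
  refine (Measure.pi_eq fun s hs => ?_).symm
  rw [Measure.map_apply hm (.univ_pi hs)]
  have : (fun p : ℝ × (Fin n → ℝ) => Function.update p.2 i p.1) ⁻¹' Set.univ.pi s
      = s i ×ˢ Set.univ.pi (Function.update s i Set.univ) := by
    ext p
    simp only [Set.mem_preimage, Set.mem_univ_pi, Set.mem_prod]
    refine ⟨fun h => ⟨by simpa using h i, fun j => ?_⟩, fun h j => ?_⟩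
    · rcases eq_or_ne j i with rfl | hj
      · simp
      · simpa [hj] using h j
    · rcases eq_or_ne j i with rfl | hj
      · simpa using h.1
      · simpa [hj] using h.2 j
  rw [this, Measure.prod_prod, restrict_cube_eq_pi, Measure.pi_pi,
    ← Finset.mul_prod_erase _ _ (Finset.mem_univ i),
    ← Finset.mul_prod_erase Finset.univ _ (Finset.mem_univ i)]
  rw [Function.update_self, measure_univ, one_mul]
  congr 1
  refine Finset.prod_congr rfl fun j hj => ?_
  rw [Function.update_of_ne (Finset.ne_of_mem_erase hj)]

lemma measurable_update_const {n : ℕ} (i : Fin n) (t : ℝ) :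
    Measurable fun x : Fin n → ℝ => Function.update x i t :=
  measurable_update_left

/-- The one-dimensional marginal of `f` in dimension `i`. -/
def marginal {n : ℕ} (i : Fin n) (f : (Fin n → ℝ) → ℝ) (t : ℝ) : ℝ :=
  ∫ x in cube n, f (Function.update x i t)

lemma measurable_marginal {n : ℕ} (i : Fin n) {f : (Fin n → ℝ) → ℝ} (hf : Measurable f) :
    Measurable (marginal i f) :=
  (StronglyMeasurable.integral_prod_right (f := fun t x => f (Function.update x i t))
    (ν := volume.restrict (cube n))
    (hf.comp (measurePreserving_update i).measurable).stronglyMeasurable).measurable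

lemma marginal_mem {n : ℕ} (i : Fin n) {f : (Fin n → ℝ) → ℝ} (hf : Measurable f)
    (hf01 : ∀ x, f x ∈ Set.Icc (0 : ℝ) 1) (t : ℝ) : marginal i f t ∈ Set.Icc (0 : ℝ) 1 :=
  (convex_Icc (0 : ℝ) 1).integral_mem isClosed_Icc (.of_forall fun _ => hf01 _)
    (integrable_of_mem_unitInterval (hf.comp (measurable_update_const i t)) fun _ => hf01 _)

lemma integral_eq_integral_marginal {n : ℕ} (i : Fin n) {f : (Fin n → ℝ) → ℝ}
    (hf : Integrable f (volume.restrict (cube n))) :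
    ∫ x in cube n, f x = ∫ t in Set.Icc (0 : ℝ) 1, marginal i f t := by
  have mp := measurePreserving_update i
  have e : ∫ x in cube n, f x = ∫ p, f (Function.update p.2 i p.1)
      ∂((volume.restrict (Set.Icc (0 : ℝ) 1)).prod (volume.restrict (cube n))) := by
    conv_lhs => rw [← mp.map_eq]
    exact integral_map mp.aemeasurable (by rw [mp.map_eq]; exact hf.aestronglyMeasurable)
  rw [e, integral_prod]
  · rfl
  · exact mp.integrable_comp_of_integrable hf

lemma ae_ae_update {n : ℕ} (i : Fin n) {p : (Fin n → ℝ) → Prop}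
    (h : ∀ᵐ x ∂volume.restrict (cube n), p x) :
    ∀ᵐ t ∂volume.restrict (Set.Icc (0 : ℝ) 1), ∀ᵐ x ∂volume.restrict (cube n),
      p (Function.update x i t) :=
  Measure.ae_ae_of_ae_prod ((measurePreserving_update i).quasiMeasurePreserving.ae h)

lemma marginal_congr_ae {n : ℕ} (i : Fin n) {f g : (Fin n → ℝ) → ℝ}
    (h : f =ᵐ[volume.restrict (cube n)] g) :
    marginal i f =ᵐ[volume.restrict (Set.Icc (0 : ℝ) 1)] marginal i g := by
  filter_upwards [ae_ae_update i h] with t ht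
  exact integral_congr_ae ht

lemma setIntegral_marginal {n : ℕ} (i : Fin n) {f : (Fin n → ℝ) → ℝ} (hf : Measurable f)
    (hf01 : ∀ x, f x ∈ Set.Icc (0 : ℝ) 1) {s : Set ℝ} (hs : MeasurableSet s) :
    ∫ t in s, marginal i f t ∂volume.restrict (Set.Icc (0 : ℝ) 1)
      = ∫ x in (fun x : Fin n → ℝ => x i) ⁻¹' s, f x ∂volume.restrict (cube n) := by
  have hs' : MeasurableSet ((fun x : Fin n → ℝ => x i) ⁻¹' s) := measurable_pi_apply i hs
  rw [← integral_indicator hs, ← integral_indicator hs', integral_eq_integral_marginal i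
    ((integrable_of_mem_unitInterval hf hf01).indicator hs')]
  congr 1
  ext t
  by_cases ht : t ∈ s <;> simp [marginal, Set.indicator, ht]

/-- Equality of the integrals over all slabs orthogonal to direction `i` forces equality of the
marginals in dimension `i`. -/
lemma marginal_ae_eq {n : ℕ} (i : Fin n) {f g : (Fin n → ℝ) → ℝ} (hf : Measurable f)
    (hf01 : ∀ x, f x ∈ Set.Icc (0 : ℝ) 1) (hg : Measurable g)
    (hg01 : ∀ x, g x ∈ Set.Icc (0 : ℝ) 1)
    (h : ∀ s : Set ℝ, MeasurableSet s →
      ∫ x in (fun x : Fin n → ℝ => x i) ⁻¹' s, f x ∂volume.restrict (cube n)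
        = ∫ x in (fun x : Fin n → ℝ => x i) ⁻¹' s, g x ∂volume.restrict (cube n)) :
    marginal i f =ᵐ[volume.restrict (Set.Icc (0 : ℝ) 1)] marginal i g := by
  refine Integrable.ae_eq_of_forall_setIntegral_eq _ _
    (integrable_of_mem_unitInterval (measurable_marginal i hf) (marginal_mem i hf hf01))
    (integrable_of_mem_unitInterval (measurable_marginal i hg) (marginal_mem i hg hg01))
    fun s hs _ => ?_
  rw [setIntegral_marginal i hf hf01 hs, setIntegral_marginal i hg hg01 hs, h s hs]

/-- Perturbing a function of least norm by moving mass along direction `i` shows that it is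
nondecreasing in direction `i`, provided that its marginal in dimension `i` is. -/
lemma ae_le_add_single {n : ℕ} (i : Fin n) {f : (Fin n → ℝ) → ℝ} (hf : Measurable f)
    (hf01 : ∀ x, f x ∈ Set.Icc (0 : ℝ) 1) {q : ℝ → ℝ} (hq : MonotoneOn q (Set.Icc 0 1))
    (hfq : marginal i f =ᵐ[volume.restrict (Set.Icc (0 : ℝ) 1)] q)
    (hmin : ∀ h : (Fin n → ℝ) → ℝ, Measurable h → (∀ x, h x ∈ Set.Icc (0 : ℝ) 1) →
      (∀ (j : Fin n) (s : Set ℝ), MeasurableSet s →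
        ∫ x in (fun x : Fin n → ℝ => x j) ⁻¹' s, h x ∂volume.restrict (cube n)
          = ∫ x in (fun x : Fin n → ℝ => x j) ⁻¹' s, f x ∂volume.restrict (cube n)) →
      0 ≤ ∫ x in cube n, f x * (h x - f x))
    {d : ℝ} (hd : 0 ≤ d) :
    ∀ᵐ x, x ∈ cube n → x + Pi.single i d ∈ cube n → f x ≤ f (x + Pi.single i d) := by
  set v : Fin n → ℝ := Pi.single i d
  have hcube : MeasurableSet (cube n) := measurableSet_Icc
  have mem_iff : ∀ x ∈ cube n, (x + v ∈ cube n ↔ x i + d ≤ 1) := by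
    intro x hx
    refine ⟨fun h => by simpa [v] using h.2 i, fun h => ⟨fun j => ?_, fun j => ?_⟩⟩
    · exact add_nonneg (hx.1 j) ((Pi.single_nonneg (α := fun _ : Fin n => ℝ)).2 hd j)
    · rcases eq_or_ne j i with rfl | hj
      · simpa [v] using h
      · simpa [v, hj] using hx.2 j
  have upd : ∀ (x : Fin n → ℝ) t, Function.update x i t + v = Function.update x i (t + d) := by
    intro x t
    ext j
    rcases eq_or_ne j i with rfl | hj <;> simp [v, *]
  have int : ∀ {g : (Fin n → ℝ) → ℝ}, Measurable g → (∀ x, g x ∈ Set.Icc (0 : ℝ) 1) → ∀ s,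
      Integrable (fun x => g (Function.update x i s)) (volume.restrict (cube n)) :=
    fun hg hg01 s => integrable_of_mem_unitInterval
      (hg.comp (measurable_update_const i s)) fun x => hg01 _
  let P : (Fin n → ℝ) → ℝ := fun x => max (f x - f (x + v)) 0
  let N : (Fin n → ℝ) → ℝ := fun x => max (f (x + v) - f x) 0
  have hP : Measurable P := by fun_prop
  have hN : Measurable N := by fun_prop
  have hP01 : ∀ x, P x ∈ Set.Icc (0 : ℝ) 1 := fun x =>
    ⟨le_max_right _ _, max_le (by linarith [(hf01 x).2, (hf01 (x + v)).1]) zero_le_one⟩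
  have hN01 : ∀ x, N x ∈ Set.Icc (0 : ℝ) 1 := fun x =>
    ⟨le_max_right _ _, max_le (by linarith [(hf01 x).1, (hf01 (x + v)).2]) zero_le_one⟩
  have hPN : ∀ x, P x - N x = f x - f (x + v) := fun x => by
    rcases le_total (f x) (f (x + v)) with h | h <;> simp [P, N, h]
  have hPNmul : ∀ x, P x * N x = 0 := fun x => by
    rcases le_total (f x) (f (x + v)) with h | h <;> simp [P, N, h]
  let a : ℝ → ℝ := marginal i N
  let b : ℝ → ℝ := marginal i P
  have ha : Measurable a := measurable_marginal i hN
  have hb : Measurable b := measurable_marginal i hP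
  have ha01 : ∀ t, a t ∈ Set.Icc (0 : ℝ) 1 := marginal_mem i hN hN01
  have hb01 : ∀ t, b t ∈ Set.Icc (0 : ℝ) 1 := marginal_mem i hP hP01
  let ψ : (Fin n → ℝ) → ℝ := fun x => a (x i) * P x - b (x i) * N x
  have hψ : Measurable ψ := by fun_prop
  have hψP : ∀ x, ψ x ≤ P x := fun x => by
    nlinarith [(ha01 (x i)).2, (hP01 x).1, mul_nonneg (hb01 (x i)).1 (hN01 x).1]
  have hψN : ∀ x, -N x ≤ ψ x := fun x => by
    nlinarith [(hb01 (x i)).2, (hN01 x).1, mul_nonneg (ha01 (x i)).1 (hP01 x).1]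
  let C : Set (Fin n → ℝ) := cube n ∩ (fun x => x + v) ⁻¹' cube n
  have hC : MeasurableSet C := hcube.inter (measurable_add_const v hcube)
  let φ : (Fin n → ℝ) → ℝ := C.indicator ψ
  have hφ : Measurable φ := hψ.indicator hC
  have hφP : ∀ x, φ x ≤ P x := fun x =>
    Set.indicator_apply_le' (fun _ => hψP x) fun _ => (hP01 x).1
  have hφN : ∀ x, -N x ≤ φ x := fun x =>
    Set.le_indicator_apply (fun _ => hψN x) fun _ => neg_nonpos.2 (hN01 x).1
  have hφ_bound : ∀ x, ‖φ x‖ ≤ 1 := fun x => by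
    rw [Real.norm_eq_abs, abs_le]
    exact ⟨by linarith [hφN x, (hN01 x).2], by linarith [hφP x, (hP01 x).2]⟩
  let h : (Fin n → ℝ) → ℝ := fun x => f x - φ x / 2 + φ (x - v) / 2
  have hh : Measurable h := by fun_prop
  have hh01 : ∀ x, h x ∈ Set.Icc (0 : ℝ) 1 := by
    intro x
    have h1 : P x ≤ f x := max_le (by linarith [(hf01 (x + v)).1]) (hf01 x).1
    have h2 : N x ≤ 1 - f x :=
      max_le (by linarith [(hf01 (x + v)).2]) (by linarith [(hf01 x).2])
    have h3 : P (x - v) ≤ 1 - f x := by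
      simp only [P, sub_add_cancel]
      exact max_le (by linarith [(hf01 (x - v)).2]) (by linarith [(hf01 x).2])
    have h4 : N (x - v) ≤ f x := by
      simp only [N, sub_add_cancel]
      exact max_le (by linarith [(hf01 (x - v)).1]) (hf01 x).1
    constructor <;> simp only [h] <;>
      linarith [hφP x, hφN x, hφP (x - v), hφN (x - v)]
  have bdd_int : ∀ {g : (Fin n → ℝ) → ℝ} (c : ℝ), Measurable g → (∀ x, ‖g x‖ ≤ c) →
      Integrable g (volume.restrict (cube n)) := fun c hg hgc =>
    Integrable.of_bound hg.aestronglyMeasurable c (.of_forall hgc)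
  have key : ∀ g : (Fin n → ℝ) → ℝ, Measurable g → (∀ x, g x ∈ Set.Icc (0 : ℝ) 1) →
      ∫ x in cube n, g x * (h x - f x) = (∫ x in cube n, (g (x + v) - g x) * φ x) / 2 := by
    intro g hg hg01
    have bd : ∀ y z, ‖g y * φ z‖ ≤ 1 := fun y z => by
      rw [norm_mul, Real.norm_of_nonneg (hg01 y).1]
      exact mul_le_one₀ (hg01 y).2 (norm_nonneg _) (hφ_bound z)
    have shift : ∫ x in cube n, g x * φ (x - v) = ∫ x in cube n, g (x + v) * φ x := by
      rw [setIntegral_eq_integral_of_forall_compl_eq_zero,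
        setIntegral_eq_integral_of_forall_compl_eq_zero,
        ← integral_add_right_eq_self (fun x => g x * φ (x - v)) v]
      · simp only [add_sub_cancel_right]
      · intro x hx
        rw [show φ x = 0 from Set.indicator_of_notMem (fun hxC => hx hxC.1) _, mul_zero]
      · intro x hx
        rw [show φ (x - v) = 0 from Set.indicator_of_notMem
          (fun hxC => hx (by simpa using hxC.2)) _, mul_zero]
    have i1 := bdd_int (g := fun x => g x * φ x) 1 (by fun_prop) fun x => bd _ _
    have i2 := bdd_int (g := fun x => g x * φ (x - v)) 1 (by fun_prop) fun x => bd _ _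
    have i3 := bdd_int (g := fun x => g (x + v) * φ x) 1 (by fun_prop) fun x => bd _ _
    calc ∫ x in cube n, g x * (h x - f x)
        = ∫ x in cube n, (g x * φ (x - v) - g x * φ x) / 2 := by
          congr 1; ext x; simp only [h]; ring
      _ = (∫ x in cube n, (g (x + v) * φ x - g x * φ x)) / 2 := by
          rw [integral_div, integral_sub i2 i1, integral_sub i3 i1, shift]
      _ = _ := by simp only [sub_mul]
  have fiber : ∀ w : ℝ → ℝ, Measurable w → (∀ t, ‖w t‖ ≤ 1) →
      ∫ x in cube n, w (x i) * φ x = 0 := by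
    intro w hw hw1
    let w' : ℝ → ℝ := {t | t + d ≤ 1}.indicator w
    have hw' : Measurable w' :=
      hw.indicator (measurableSet_le (by fun_prop) (by fun_prop))
    have hw1' : ∀ t, ‖w' t‖ ≤ 1 := fun t => (norm_indicator_le_norm_self w t).trans (hw1 t)
    have e : ∫ x in cube n, w (x i) * φ x = ∫ x in cube n, w' (x i) * ψ x := by
      refine setIntegral_congr_fun hcube fun x hx => ?_
      by_cases hxi : x i + d ≤ 1
      · have : x ∈ C := ⟨hx, (mem_iff x hx).2 hxi⟩
        simp [φ, w', this, hxi]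
      · have : x ∉ C := fun hxC => hxi ((mem_iff x hx).1 hxC.2)
        simp [φ, w', this, hxi]
    rw [e, integral_eq_integral_marginal i]
    · refine integral_eq_zero_of_ae (.of_forall fun t => ?_)
      simp only [marginal, ψ, Function.update_self, Pi.zero_apply]
      rw [integral_const_mul,
        integral_sub ((int hP hP01 t).const_mul _) ((int hN hN01 t).const_mul _),
        integral_const_mul, integral_const_mul]
      change w' t * (a t * b t - b t * a t) = 0
      ring
    · refine bdd_int 1 (by fun_prop) fun x => ?_
      rw [norm_mul]
      refine mul_le_one₀ (hw1' _) (norm_nonneg _) ?_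
      rw [Real.norm_eq_abs, abs_le]
      exact ⟨by linarith [hψN x, (hN01 x).2], by linarith [hψP x, (hP01 x).2]⟩
  have hslab : ∀ (j : Fin n) (s : Set ℝ), MeasurableSet s →
      ∫ x in (fun x : Fin n → ℝ => x j) ⁻¹' s, h x ∂volume.restrict (cube n)
        = ∫ x in (fun x : Fin n → ℝ => x j) ⁻¹' s, f x ∂volume.restrict (cube n) := by
    intro j s hs
    have hs' : MeasurableSet ((fun x : Fin n → ℝ => x j) ⁻¹' s) := measurable_pi_apply j hs
    let g : ℝ → ℝ := s.indicator 1
    have hg : Measurable g := measurable_one.indicator hs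
    have hg01 : ∀ t, g t ∈ Set.Icc (0 : ℝ) 1 := fun t =>
      ⟨Set.indicator_nonneg (by simp) t, Set.indicator_le_self' (by simp) t⟩
    rw [← sub_eq_zero, ← integral_sub (integrable_of_mem_unitInterval hh hh01)
      (integrable_of_mem_unitInterval hf hf01), ← integral_indicator hs']
    have e : ((fun x : Fin n → ℝ => x j) ⁻¹' s).indicator (fun x => h x - f x)
        = fun x => g (x j) * (h x - f x) := by
      ext x
      by_cases hx : x j ∈ s <;> simp [g, Set.indicator, hx]
    rw [e, key (fun x => g (x j)) (by fun_prop) fun x => hg01 _]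
    rcases eq_or_ne j i with rfl | hj
    · have := fiber (fun t => g (t + d) - g t) (by fun_prop) fun t => by
        rw [Real.norm_eq_abs, abs_le]
        constructor <;> linarith [(hg01 t).1, (hg01 t).2, (hg01 (t + d)).1, (hg01 (t + d)).2]
      simp only [v, Pi.add_apply, Pi.single_eq_same]
      rw [this, zero_div]
    · simp [v, hj]
  have hge := hmin h hh hh01 hslab
  rw [key f hf hf01] at hge
  have prod_eq : ∀ x, (f x - f (x + v)) * φ x
      = C.indicator (fun x => a (x i) * P x ^ 2 + b (x i) * N x ^ 2) x := by
    intro x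
    by_cases hx : x ∈ C
    · simp only [φ, Set.indicator_of_mem hx, ψ]
      linear_combination (-(a (x i) * P x - b (x i) * N x)) * hPN x
        - (a (x i) + b (x i)) * hPNmul x
    · simp [φ, hx]
  have prod_nonneg : ∀ x, 0 ≤ (f x - f (x + v)) * φ x := fun x => by
    rw [prod_eq]
    exact Set.indicator_nonneg (fun x _ => add_nonneg (mul_nonneg (ha01 _).1 (sq_nonneg _))
      (mul_nonneg (hb01 _).1 (sq_nonneg _))) x
  have prod_ae : (fun x => (f x - f (x + v)) * φ x) =ᵐ[volume.restrict (cube n)] 0 := by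
    refine (integral_eq_zero_iff_of_nonneg prod_nonneg (bdd_int 1 (by fun_prop) fun x => ?_)).1 ?_
    · rw [norm_mul]
      refine mul_le_one₀ ?_ (norm_nonneg _) (hφ_bound x)
      rw [Real.norm_eq_abs, abs_le]
      constructor <;> linarith [(hf01 x).1, (hf01 x).2, (hf01 (x + v)).1, (hf01 (x + v)).2]
    · refine le_antisymm ?_ (integral_nonneg prod_nonneg)
      have : ∫ x in cube n, (f (x + v) - f x) * φ x
          = -∫ x in cube n, (f x - f (x + v)) * φ x := by
        rw [← integral_neg]; congr 1; ext x; ring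
      linarith
  have zero_ae : ∀ᵐ x ∂volume.restrict (cube n), x i + d ≤ 1 →
      a (x i) * P x = 0 ∧ b (x i) * N x = 0 := by
    filter_upwards [prod_ae, ae_restrict_mem hcube] with x hx hxc hxi
    have hxC : x ∈ C := ⟨hxc, (mem_iff x hxc).2 hxi⟩
    rw [prod_eq, Set.indicator_of_mem hxC, Pi.zero_apply] at hx
    have h1 := mul_nonneg (ha01 (x i)).1 (sq_nonneg (P x))
    have h2 := mul_nonneg (hb01 (x i)).1 (sq_nonneg (N x))
    have h3 : a (x i) * P x ^ 2 = 0 := by linarith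
    have h4 : b (x i) * N x ^ 2 = 0 := by linarith
    simpa using And.intro h3 h4
  have hle : ∀ᵐ t ∂volume.restrict (Set.Icc (0 : ℝ) 1), t + d ≤ 1 → b t ≤ a t := by
    have h1 := (ae_restrict_iff' measurableSet_Icc).1 hfq
    have h2 := (measurePreserving_add_right volume d).quasiMeasurePreserving.ae h1
    rw [ae_restrict_iff' measurableSet_Icc]
    filter_upwards [h1, h2] with t h1 h2 ht htd
    have htd' : t + d ∈ Set.Icc (0 : ℝ) 1 := ⟨by linarith [ht.1], htd⟩
    have hle := hq ht htd' (by linarith)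
    rw [← h1 ht, ← h2 htd'] at hle
    have : b t - a t = marginal i f t - marginal i f (t + d) := by
      simp only [a, b, marginal]
      rw [← integral_sub (int hP hP01 t) (int hN hN01 t),
        ← integral_sub (int hf hf01 t) (int hf hf01 (t + d))]
      congr 1
      ext x
      rw [hPN, upd]
    linarith
  have hPzero : ∀ᵐ t ∂volume.restrict (Set.Icc (0 : ℝ) 1), t + d ≤ 1 → b t = 0 := by
    filter_upwards [hle, ae_ae_update i zero_ae] with t ht hz htd
    have : a t * b t = 0 := by
      change a t * ∫ x in cube n, P (Function.update x i t) = 0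
      rw [← integral_const_mul]
      refine integral_eq_zero_of_ae ?_
      filter_upwards [hz] with x hx
      simpa using (hx (by simpa using htd)).1
    nlinarith [ht htd, (hb01 t).1, (ha01 t).1]
  let B : Set (Fin n → ℝ) := (fun x => x i) ⁻¹' {t | t + d ≤ 1}
  have hB : MeasurableSet B :=
    measurable_pi_apply i (measurableSet_le (by fun_prop) (by fun_prop))
  have hPint : ∫ x in B, P x ∂volume.restrict (cube n) = 0 := by
    rw [← setIntegral_marginal i hP hP01 (measurableSet_le (by fun_prop) (by fun_prop))]
    refine integral_eq_zero_of_ae ?_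
    rw [Filter.EventuallyEq, ae_restrict_iff' (measurableSet_le (by fun_prop) (by fun_prop))]
    exact hPzero
  rw [integral_eq_zero_iff_of_nonneg (fun x => (hP01 x).1)
    (integrable_of_mem_unitInterval hP hP01), Filter.EventuallyEq, ae_restrict_iff' hB,
    ae_restrict_iff' hcube] at hPint
  filter_upwards [hPint] with x hx hxc hxv
  have : P x ≤ 0 := (hx hxc ((mem_iff x hxc).1 hxv)).le
  linarith [(le_max_left _ _).trans this]

/-- A function on the cube that is almost everywhere nondecreasing in every coordinate direction
agrees almost everywhere with a monotone function. -/
lemma exists_monotone_ae_eq_cube {n : ℕ} {f : (Fin n → ℝ) → ℝ} (hf : Measurable f)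
    (hf01 : ∀ x, f x ∈ Set.Icc (0 : ℝ) 1)
    (hmono : ∀ (i : Fin n) (d : ℝ), 0 ≤ d → ∀ᵐ x, x ∈ cube n → x + Pi.single i d ∈ cube n →
      f x ≤ f (x + Pi.single i d)) :
    ∃ F : (Fin n → ℝ) → ℝ, Monotone F ∧ (∀ x, F x ∈ Set.Icc (0 : ℝ) 1) ∧
      F =ᵐ[volume.restrict (cube n)] f := by
  have hcube : MeasurableSet (cube n) := measurableSet_Icc
  let U : Set (Fin n → ℝ) := {x | x ≤ 1}
  have hU : MeasurableSet U := measurableSet_Iic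
  let g : (Fin n → ℝ) → ℝ := (cube n).indicator f + Uᶜ.indicator 1
  have hg : Measurable g := (hf.indicator hcube).add (measurable_one.indicator hU.compl)
  have g_out : ∀ x, x ∉ U → g x = 1 := fun x hx => by
    have : x ∉ cube n := fun h => hx h.2
    simp [g, hx, this]
  have g_in : ∀ x ∈ cube n, g x = f x := fun x hx => by
    have : x ∈ U := hx.2
    simp [g, hx, this]
  have g_low : ∀ x ∈ U, x ∉ cube n → g x = 0 := fun x hx hx' => by
    simp [g, hx, hx']
  have hg01 : ∀ x, g x ∈ Set.Icc (0 : ℝ) 1 := by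
    intro x
    by_cases hx : x ∈ U
    · by_cases hx' : x ∈ cube n
      · rw [g_in x hx']; exact hf01 x
      · rw [g_low x hx hx']; simp
    · rw [g_out x hx]; simp
  have single : ∀ (i : Fin n) (d : ℝ), 0 ≤ d → ∀ᵐ x, g x ≤ g (x + Pi.single i d) := by
    intro i d hd
    filter_upwards [hmono i d hd] with x hx
    have hle : x ≤ x + Pi.single i d := le_add_of_nonneg_right (Pi.single_nonneg.2 hd)
    by_cases h1 : x + Pi.single i d ∈ U
    · by_cases h2 : x ∈ cube n
      · have h3 : x + Pi.single i d ∈ cube n := ⟨h2.1.trans hle, h1⟩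
        rw [g_in _ h2, g_in _ h3]
        exact hx h2 h3
      · rw [g_low x (hle.trans h1) h2]
        exact (hg01 _).1
    · rw [g_out _ h1]
      exact (hg01 x).2
  have all : ∀ v : Fin n → ℝ, 0 ≤ v → ∀ᵐ x, g x ≤ g (x + v) := by
    intro v hv
    rw [← Finset.univ_sum_single v]
    refine Finset.sum_induction _ (fun w => ∀ᵐ x, g x ≤ g (x + w)) (fun w w' h h' => ?_)
      (by simp) fun i _ => single i (v i) (hv i)
    filter_upwards [h, (measurePreserving_add_right volume w).quasiMeasurePreserving.ae h']
      with x h1 h2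
    rw [← add_assoc]
    exact h1.trans h2
  obtain ⟨F, hF, hF01, hFg⟩ := exists_monotone_ae_eq hg hg01 all
  refine ⟨F, hF, hF01, ?_⟩
  filter_upwards [ae_restrict_of_ae hFg, ae_restrict_mem hcube] with x h1 h2
  rw [h1, g_in x h2]

/-- Gutmann et al.: a tuple of nondecreasing left-continuous functions
is rationalizable iff it is rationalized by some monotone function on the cube. -/
theorem stmt18 (n : ℕ) (hn : 1 ≤ n) (q : Fin n → ℝ → ℝ) (hq : ∀ i, MonoLC (q i)) :
    (∃ f, RationalizesN n f q) ↔
      ∃ f, (∀ x ∈ cube n, ∀ y ∈ cube n, x ≤ y → f x ≤ f y) ∧ RationalizesN n f q := by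
  refine ⟨?_, fun ⟨f, _, hf⟩ => ⟨f, hf⟩⟩
  rintro ⟨r, hr, hr01, hrq⟩
  let f₀ : (Fin n → ℝ) → ℝ := fun x => max 0 (min 1 (hr.mk r x))
  have hf₀ : Measurable f₀ := by have := hr.measurable_mk; fun_prop
  have hf₀01 : ∀ x, f₀ x ∈ Set.Icc (0 : ℝ) 1 := fun x => ⟨by simp [f₀], by simp [f₀]⟩
  have hf₀r : f₀ =ᵐ[volume.restrict (cube n)] r := by
    filter_upwards [hr.ae_eq_mk, ae_restrict_mem (measurableSet_Icc : MeasurableSet (cube n))]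
      with x h1 h2
    simp only [f₀]
    rw [← h1, min_eq_right (hr01 x h2).2, max_eq_right (hr01 x h2).1]
  let 𝒮 : Set (Set (Fin n → ℝ)) :=
    {S | ∃ (j : Fin n) (s : Set ℝ), MeasurableSet s ∧ S = (fun x => x j) ⁻¹' s}
  obtain ⟨f, hf, hf01, hfs, hmin⟩ := exists_least_norm (volume.restrict (cube n)) 𝒮
    (by rintro _ ⟨j, s, hs, rfl⟩; exact measurable_pi_apply j hs) hf₀ hf₀01
  have hfq : ∀ i, marginal i f =ᵐ[volume.restrict (Set.Icc (0 : ℝ) 1)] q i := fun i => by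
    have h1 := marginal_ae_eq i hf hf01 hf₀ hf₀01 fun s hs => hfs _ ⟨i, s, hs, rfl⟩
    have h2 : q i =ᵐ[volume.restrict (Set.Icc (0 : ℝ) 1)] marginal i r := hrq i
    exact (h1.trans (marginal_congr_ae i hf₀r)).trans h2.symm
  obtain ⟨F, hF, hF01, hFf⟩ := exists_monotone_ae_eq_cube hf hf01 fun i d hd =>
    ae_le_add_single i hf hf01 (hq i).1 (hfq i) (fun h hm h01 hs => hmin h hm h01 <| by
      rintro _ ⟨j, s, hs', rfl⟩
      rw [hs j s hs', hfs _ ⟨j, s, hs', rfl⟩]) hd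
  exact ⟨F, fun x _ y _ hxy => hF hxy, hf.aemeasurable.congr hFf.symm, fun x _ => hF01 x,
    fun i => ((marginal_congr_ae i hFf).trans (hfq i)).symm⟩
end
end

section
/- Let q̃_1, q̃_2 : [0,1] → [0,1] be nondecreasing left-continuous functions. There exist measurable functions p_1, p_2 : [0,1]² → [0,1] with p_1(x) + p_2(x) ≤ 1 for all x ∈ [0,1]², such that q̃_1(t) = ∫_0^1 p_1(t, x_2) dx_2 for almost every t ∈ [0,1] and q̃_2(t) = ∫_0^1 p_2(x_1, t) dx_1 for almost every t ∈ [0,1], if and only if q̃_1 ⪯_w q̃_2^{-1}, i.e., q̃_1 is weakly majorized by the generalized inverse of q̃_2. -/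
open MeasureTheory

noncomputable section

section Implementation

open Set

/-- The tail integral `t ↦ ∫_t^1 a`. -/
def tailInt (a : ℝ → ℝ) (t : ℝ) : ℝ := ∫ u in t..1, a u

/-- The generalized inverse of the tail integral on `[0,1]`. -/
def tailInv (a : ℝ → ℝ) (m : ℝ) : ℝ := sInf {u | u ∈ Icc (0 : ℝ) 1 ∧ tailInt a u ≤ max m 0}

/-- The measure on `[0,1]` with density `a`. -/
def densMeas (a : ℝ → ℝ) : Measure ℝ :=
  (volume.restrict (Icc (0 : ℝ) 1)).withDensity (fun t => ENNReal.ofReal (a t))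

lemma tailInt_continuous {a : ℝ → ℝ} (ha : Integrable a) : Continuous (tailInt a) := by
  have h := intervalIntegral.continuous_primitive (μ := volume) (f := a)
    (fun _ _ => ha.intervalIntegrable) 1
  have : tailInt a = fun t => - ∫ u in (1 : ℝ)..t, a u := by
    funext t
    exact intervalIntegral.integral_symm _ _
  rw [this]
  exact h.neg

lemma tailInt_antitone {a : ℝ → ℝ} (ha : Integrable a) (h0 : ∀ t, 0 ≤ a t) :
    Antitone (tailInt a) := by
  intro s t hst
  have h := intervalIntegral.integral_add_adjacent_intervals
    (ha.intervalIntegrable (a := s) (b := t)) (ha.intervalIntegrable (a := t) (b := 1))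
  have h' : 0 ≤ ∫ u in s..t, a u := intervalIntegral.integral_nonneg hst fun u _ => h0 u
  simp only [tailInt]
  linarith

lemma tailInt_one (a : ℝ → ℝ) : tailInt a 1 = 0 := by simp [tailInt]

lemma tailInt_nonneg {a : ℝ → ℝ} (ha : Integrable a) (h0 : ∀ t, 0 ≤ a t) {t : ℝ} (ht : t ≤ 1) :
    0 ≤ tailInt a t := tailInt_one a ▸ tailInt_antitone ha h0 ht

lemma tailInv_mem {a : ℝ → ℝ} (ha : Integrable a) (m : ℝ) :
    tailInv a m ∈ Icc (0 : ℝ) 1 ∧ tailInt a (tailInv a m) ≤ max m 0 := by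
  have hc : IsClosed {u | u ∈ Icc (0 : ℝ) 1 ∧ tailInt a u ≤ max m 0} :=
    isClosed_Icc.inter (isClosed_le (tailInt_continuous ha) continuous_const)
  exact hc.csInf_mem ⟨1, ⟨by simp, by simp [tailInt_one]⟩⟩ ⟨0, fun u hu => hu.1.1⟩

lemma tailInv_le (a : ℝ → ℝ) {m u : ℝ} (hu : u ∈ Icc (0 : ℝ) 1) (h : tailInt a u ≤ max m 0) :
    tailInv a m ≤ u := csInf_le ⟨0, fun _ hu => hu.1.1⟩ ⟨hu, h⟩

lemma tailInv_antitone {a : ℝ → ℝ} (ha : Integrable a) : Antitone (tailInv a) :=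
  fun m _ hmn => tailInv_le a (tailInv_mem ha m).1
    ((tailInv_mem ha m).2.trans (max_le_max_right 0 hmn))

lemma tailInv_mono {a b : ℝ → ℝ} (hb : Integrable b)
    (hab : ∀ t ∈ Icc (0 : ℝ) 1, tailInt a t ≤ tailInt b t) (m : ℝ) :
    tailInv a m ≤ tailInv b m :=
  tailInv_le a (tailInv_mem hb m).1 ((hab _ (tailInv_mem hb m).1).trans (tailInv_mem hb m).2)

lemma tailInt_tailInv {a : ℝ → ℝ} (ha : Integrable a) (h0 : ∀ t, 0 ≤ a t) {m : ℝ} (hm : 0 ≤ m) :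
    tailInt a (tailInv a m) = min m (tailInt a 0) := by
  obtain ⟨h1, h2⟩ := tailInv_mem ha m
  rw [max_eq_left hm] at h2
  have hanti := tailInt_antitone ha h0
  refine le_antisymm (le_min h2 (hanti h1.1)) ?_
  have hmem : min m (tailInt a 0) ∈ Icc (tailInt a 1) (tailInt a 0) := by
    rw [tailInt_one]
    exact ⟨le_min hm (tailInt_nonneg ha h0 zero_le_one), min_le_right _ _⟩
  obtain ⟨u, hu, hue⟩ := intermediate_value_Icc' zero_le_one
    (tailInt_continuous ha).continuousOn hmem
  rw [← hue]
  exact hanti (tailInv_le a hu (hue ▸ (min_le_left _ _).trans (le_max_left _ _)))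

lemma densMeas_Icc {a : ℝ → ℝ} (ha : Integrable a) (h0 : ∀ t, 0 ≤ a t) {s : ℝ}
    (hs : s ∈ Icc (0 : ℝ) 1) : densMeas a (Icc s 1) = ENNReal.ofReal (tailInt a s) := by
  rw [densMeas, withDensity_apply _ measurableSet_Icc, Measure.restrict_restrict measurableSet_Icc,
    Icc_inter_Icc, sup_eq_left.2 hs.1, inf_idem, tailInt, intervalIntegral.integral_of_le hs.2,
    ← integral_Icc_eq_integral_Ioc,
    ofReal_integral_eq_lintegral_ofReal ha.integrableOn (Filter.Eventually.of_forall h0)]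

lemma densMeas_compl (a : ℝ → ℝ) : densMeas a (Icc 0 1)ᶜ = 0 := by
  rw [densMeas, withDensity_apply _ measurableSet_Icc.compl,
    Measure.restrict_restrict measurableSet_Icc.compl]
  simp

lemma densMeas_finite {a : ℝ → ℝ} (ha : Integrable a) (h0 : ∀ t, 0 ≤ a t) :
    IsFiniteMeasure (densMeas a) := by
  refine ⟨?_⟩
  rw [← union_compl_self (Icc (0 : ℝ) 1)]
  refine (measure_union_le _ _).trans_lt ?_
  rw [densMeas_compl, densMeas_Icc ha h0 (by simp), add_zero]
  exact ENNReal.ofReal_lt_top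

lemma map_tailInt_densMeas {a : ℝ → ℝ} (ha : Integrable a) (h0 : ∀ t, 0 ≤ a t) :
    (densMeas a).map (tailInt a) = volume.restrict (Icc 0 (tailInt a 0)) := by
  have := densMeas_finite ha h0
  have hmeas := (tailInt_continuous ha).measurable
  apply Measure.ext_of_Iic
  intro m
  have hz : densMeas a (tailInt a ⁻¹' Iic m \ Icc 0 1) = 0 :=
    measure_mono_null (fun _ h => h.2) (densMeas_compl a)
  rw [Measure.map_apply hmeas measurableSet_Iic, Measure.restrict_apply measurableSet_Iic,
    ← measure_inter_add_sdiff _ (measurableSet_Icc (a := (0 : ℝ)) (b := 1)), hz, add_zero]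
  rcases lt_or_ge m 0 with hm | hm
  · have h1 : tailInt a ⁻¹' Iic m ∩ Icc 0 1 = ∅ := by
      ext t
      simp only [mem_inter_iff, mem_preimage, mem_Iic, mem_Icc, mem_empty_iff_false, iff_false]
      rintro ⟨h, _, h1⟩
      linarith [tailInt_nonneg ha h0 h1]
    have h2 : Iic m ∩ Icc 0 (tailInt a 0) = ∅ := by
      ext t
      simp only [mem_inter_iff, mem_Iic, mem_Icc, mem_empty_iff_false, iff_false]
      rintro ⟨h, h1, _⟩
      linarith
    rw [h1, h2, measure_empty, measure_empty]
  · have h1 : tailInt a ⁻¹' Iic m ∩ Icc 0 1 = Icc (tailInv a m) 1 := by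
      ext t
      simp only [mem_inter_iff, mem_preimage, mem_Iic]
      constructor
      · rintro ⟨h, ht⟩
        exact ⟨tailInv_le a ht (h.trans (le_max_left _ _)), ht.2⟩
      · rintro ⟨h, ht⟩
        obtain ⟨h1, h2⟩ := tailInv_mem ha m
        rw [max_eq_left hm] at h2
        exact ⟨(tailInt_antitone ha h0 h).trans h2, h1.1.trans h, ht⟩
    have h2 : Iic m ∩ Icc 0 (tailInt a 0) = Icc 0 (min m (tailInt a 0)) := by
      ext t
      simp only [mem_inter_iff, mem_Iic, mem_Icc, le_min_iff]
      tauto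
    rw [h1, h2, densMeas_Icc ha h0 (tailInv_mem ha m).1, tailInt_tailInv ha h0 hm]
    simp

lemma tailInv_tailInt_ae {a : ℝ → ℝ} (ha : Integrable a) (h0 : ∀ t, 0 ≤ a t) :
    ∀ᵐ t ∂(densMeas a), tailInv a (tailInt a t) = t := by
  have hmeas := (tailInt_continuous ha).measurable
  have hlev : ∀ c : ℝ, densMeas a (tailInt a ⁻¹' {c}) = 0 := by
    intro c
    rw [← Measure.map_apply hmeas (measurableSet_singleton c), map_tailInt_densMeas ha h0]
    exact measure_mono_null (fun _ h => h) (by simp)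
  have hq : ∀ᵐ t ∂(densMeas a), ∀ r : ℚ, tailInt a t ≠ tailInt a r := by
    rw [ae_all_iff]
    intro r
    rw [ae_iff]
    simp only [ne_eq, not_not]
    exact hlev (tailInt a r)
  have hI : ∀ᵐ t ∂(densMeas a), t ∈ Icc (0 : ℝ) 1 := densMeas_compl a
  filter_upwards [hq, hI] with t ht htI
  have hanti := tailInt_antitone ha h0
  have hle := tailInv_le a htI (le_max_left (tailInt a t) 0)
  by_contra hne
  obtain ⟨r, hr1, hr2⟩ := exists_rat_btwn (lt_of_le_of_ne hle hne)
  have hnn := tailInt_nonneg ha h0 htI.2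
  refine ht r (le_antisymm (hanti hr2.le) ?_)
  refine (hanti hr1.le).trans ((tailInv_mem ha _).2.trans ?_)
  rw [max_eq_left hnn]

lemma ae_densMeas_iff {a : ℝ → ℝ} (hm : Measurable a) {P : ℝ → Prop} :
    (∀ᵐ t ∂(densMeas a), P t) ↔ ∀ᵐ t ∂(volume.restrict (Icc (0 : ℝ) 1)), 0 < a t → P t := by
  rw [densMeas, ae_withDensity_iff hm.ennreal_ofReal]
  simp

lemma integral_densMeas {a : ℝ → ℝ} (hm : Measurable a) (h0 : ∀ t, 0 ≤ a t) (f : ℝ → ℝ) :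
    ∫ t, f t ∂(densMeas a) = ∫ t in Icc (0 : ℝ) 1, a t * f t := by
  rw [densMeas, integral_withDensity_eq_integral_toReal_smul hm.ennreal_ofReal (by simp)]
  simp [ENNReal.toReal_ofReal (h0 _)]

lemma tailInv_pos_ae {a : ℝ → ℝ} (ha : Integrable a) (h0 : ∀ t, 0 ≤ a t) (hm : Measurable a) :
    ∀ᵐ m ∂(volume.restrict (Icc 0 (tailInt a 0))), 0 < a (tailInv a m) := by
  have hmeas := (tailInt_continuous ha).measurable
  have hmi : Measurable fun m => a (tailInv a m) := hm.comp (tailInv_antitone ha).measurable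
  rw [← map_tailInt_densMeas ha h0,
    ae_map_iff hmeas.aemeasurable (measurableSet_lt measurable_const hmi)]
  have h : ∀ᵐ t ∂(densMeas a), 0 < a t := (ae_densMeas_iff hm).2 (by simp)
  filter_upwards [h, tailInv_tailInt_ae ha h0] with t h1 h2
  rwa [h2]

lemma transport_up_ae {a b : ℝ → ℝ} (ha : Integrable a) (ha0 : ∀ t, 0 ≤ a t) (ham : Measurable a)
    (hb : Integrable b) (hb0 : ∀ t, 0 ≤ b t) (hbm : Measurable b)
    (hab : ∀ t ∈ Icc (0 : ℝ) 1, tailInt a t ≤ tailInt b t) :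
    ∀ᵐ t ∂(volume.restrict (Icc (0 : ℝ) 1)), 0 < a t →
      t ≤ tailInv b (tailInt a t) ∧ 0 < b (tailInv b (tailInt a t)) := by
  rw [← ae_densMeas_iff ham]
  have h1 := tailInv_pos_ae hb hb0 hbm
  have h2 := ae_restrict_of_ae_restrict_of_subset
    (Icc_subset_Icc_right (hab 0 (by simp))) h1
  rw [← map_tailInt_densMeas ha ha0] at h2
  filter_upwards [ae_of_ae_map (tailInt_continuous ha).measurable.aemeasurable h2,
    tailInv_tailInt_ae ha ha0] with t h3 h4
  exact ⟨h4.symm.trans_le (tailInv_mono hb hab _), h3⟩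

lemma transport_down_ae {a b : ℝ → ℝ} (ha : Integrable a) (ha0 : ∀ t, 0 ≤ a t)
    (ham : Measurable a) (hb : Integrable b) (hb0 : ∀ t, 0 ≤ b t) (hbm : Measurable b)
    (hab : ∀ t ∈ Icc (0 : ℝ) 1, tailInt a t ≤ tailInt b t) :
    ∀ᵐ t ∂(volume.restrict (Icc (0 : ℝ) 1)), 0 < b t → tailInt b t ≤ tailInt a 0 →
      tailInv a (tailInt b t) ≤ t ∧ 0 < a (tailInv a (tailInt b t)) := by
  rw [← ae_densMeas_iff hbm]
  have h1 := tailInv_pos_ae ha ha0 ham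
  have h2 : ∀ᵐ m ∂(volume.restrict (Icc 0 (tailInt b 0))),
      m ≤ tailInt a 0 → 0 < a (tailInv a m) := by
    rw [ae_restrict_iff' measurableSet_Icc] at h1 ⊢
    filter_upwards [h1] with m h hm hm'
    exact h ⟨hm.1, hm'⟩
  rw [← map_tailInt_densMeas hb hb0] at h2
  filter_upwards [ae_of_ae_map (tailInt_continuous hb).measurable.aemeasurable h2,
    tailInv_tailInt_ae hb hb0] with t h3 h4 h5
  exact ⟨(tailInv_mono hb hab _).trans_eq h4, h3 h5⟩

lemma integral_transport {a b : ℝ → ℝ} (ha : Integrable a) (ha0 : ∀ t, 0 ≤ a t)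
    (ham : Measurable a) (hb : Integrable b) (hb0 : ∀ t, 0 ≤ b t) (hbm : Measurable b)
    (hab : ∀ t ∈ Icc (0 : ℝ) 1, tailInt a t ≤ tailInt b t)
    {h : ℝ → ℝ → ℝ} (hh : Measurable (Function.uncurry h)) :
    ∫ t in Icc (0 : ℝ) 1, a t * h t (tailInv b (tailInt a t)) =
      ∫ t in Icc (0 : ℝ) 1, b t *
        (if tailInt b t ≤ tailInt a 0 then h (tailInv a (tailInt b t)) t else 0) := by
  have hFm := (tailInt_continuous ha).measurable
  have hGm := (tailInt_continuous hb).measurable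
  have hk : Measurable fun m => h (tailInv a m) (tailInv b m) :=
    hh.comp ((tailInv_antitone ha).measurable.prodMk (tailInv_antitone hb).measurable)
  have hk' : Measurable fun m =>
      if m ≤ tailInt a 0 then h (tailInv a m) (tailInv b m) else 0 :=
    Measurable.ite measurableSet_Iic hk measurable_const
  rw [← integral_densMeas ham ha0, ← integral_densMeas hbm hb0]
  calc ∫ t, h t (tailInv b (tailInt a t)) ∂(densMeas a)
      = ∫ t, h (tailInv a (tailInt a t)) (tailInv b (tailInt a t)) ∂(densMeas a) := by
        apply integral_congr_ae
        filter_upwards [tailInv_tailInt_ae ha ha0] with t ht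
        rw [ht]
    _ = ∫ m in Icc 0 (tailInt a 0), h (tailInv a m) (tailInv b m) := by
        rw [← map_tailInt_densMeas ha ha0,
          integral_map hFm.aemeasurable hk.aestronglyMeasurable]
    _ = ∫ m in Icc 0 (tailInt b 0),
          if m ≤ tailInt a 0 then h (tailInv a m) (tailInv b m) else 0 := by
        rw [← integral_indicator measurableSet_Icc, ← integral_indicator measurableSet_Icc]
        congr 1
        funext m
        have := hab 0 (by simp)
        by_cases h1 : 0 ≤ m <;> by_cases h2 : m ≤ tailInt a 0
        · simp [indicator, h1, h2, h2.trans this]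
        all_goals simp [indicator, h1, h2]
    _ = ∫ t, (if tailInt b t ≤ tailInt a 0 then
          h (tailInv a (tailInt b t)) (tailInv b (tailInt b t)) else 0) ∂(densMeas b) := by
        rw [← map_tailInt_densMeas hb hb0,
          integral_map hGm.aemeasurable hk'.aestronglyMeasurable]
    _ = _ := by
        apply integral_congr_ae
        filter_upwards [tailInv_tailInt_ae hb hb0] with t ht
        rw [ht]

/-- The indicator of `y ≤ c`. -/
def stepFun (c y : ℝ) : ℝ := if y ≤ c then 1 else 0

lemma stepFun_nonneg (c y : ℝ) : 0 ≤ stepFun c y := by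
  unfold stepFun; split_ifs <;> norm_num

lemma stepFun_le_one (c y : ℝ) : stepFun c y ≤ 1 := by
  unfold stepFun; split_ifs <;> norm_num

lemma stepFun_mono {c d : ℝ} (h : c ≤ d) (y : ℝ) : stepFun c y ≤ stepFun d y := by
  unfold stepFun
  split_ifs with h1 h2
  · exact le_rfl
  · exact absurd (h1.trans h) h2
  · exact zero_le_one
  · exact le_rfl

lemma measurable_stepFun : Measurable (Function.uncurry stepFun) :=
  Measurable.ite (measurableSet_le measurable_snd measurable_fst) measurable_const measurable_const

lemma Measurable.stepFun_comp {α : Type*} [MeasurableSpace α] {f k : α → ℝ} (hf : Measurable f)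
    (hk : Measurable k) : Measurable fun x => stepFun (f x) (k x) :=
  measurable_stepFun.comp (hf.prodMk hk)

lemma integrable_stepFun {α : Type*} [MeasurableSpace α] {μ : Measure α} [IsFiniteMeasure μ]
    {f k : α → ℝ} (hf : Measurable f) (hk : Measurable k) :
    Integrable (fun x => stepFun (f x) (k x)) μ := by
  refine Integrable.of_bound (hf.stepFun_comp hk).aestronglyMeasurable 1 ?_
  filter_upwards with x
  rw [Real.norm_of_nonneg (stepFun_nonneg _ _)]
  exact stepFun_le_one _ _

lemma integral_stepFun {c : ℝ} (hc : c ∈ Icc (0 : ℝ) 1) :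
    ∫ y in Icc (0 : ℝ) 1, stepFun c y = c := by
  have h : stepFun c = (Iic c).indicator 1 := by
    funext y
    simp [stepFun, indicator]
  rw [h, integral_indicator_one measurableSet_Iic, measureReal_restrict_apply measurableSet_Iic]
  have h2 : Iic c ∩ Icc 0 1 = Icc 0 c := by
    ext y
    simp only [mem_inter_iff, mem_Iic, mem_Icc]
    exact ⟨fun h => ⟨h.2.1, h.1⟩, fun h => ⟨h.2, h.1, h.2.trans hc.2⟩⟩
  rw [h2]
  simp [hc.1]

/-- The positive part of `u - v` on `[0,1]`, extended by zero. -/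
def excess (u v : ℝ → ℝ) : ℝ → ℝ := (Icc (0 : ℝ) 1).indicator fun t => max (u t - v t) 0

lemma excess_nonneg (u v : ℝ → ℝ) (t : ℝ) : 0 ≤ excess u v t :=
  indicator_nonneg (fun _ _ => le_max_right _ _) t

lemma excess_of_le {u v : ℝ → ℝ} {t : ℝ} (h : u t ≤ v t) : excess u v t = 0 := by
  simp [excess, indicator, h]

lemma excess_of_ge {u v : ℝ → ℝ} {t : ℝ} (ht : t ∈ Icc (0 : ℝ) 1) (h : v t ≤ u t) :
    excess u v t = u t - v t := by
  rw [excess, indicator_of_mem ht, max_eq_left (sub_nonneg.2 h)]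

lemma lt_of_excess_pos {u v : ℝ → ℝ} {t : ℝ} (h : 0 < excess u v t) : v t < u t := by
  by_contra! h'
  simp [excess_of_le h'] at h

lemma excess_measurable {u v : ℝ → ℝ} (hu : Measurable u) (hv : Measurable v) :
    Measurable (excess u v) :=
  ((hu.sub hv).max measurable_const).indicator measurableSet_Icc

lemma excess_integrable {u v : ℝ → ℝ} (hu : Measurable u) (hv : Measurable v)
    (hu1 : ∀ t, u t ∈ Icc (0 : ℝ) 1) (hv1 : ∀ t, v t ∈ Icc (0 : ℝ) 1) :
    Integrable (excess u v) := by
  rw [excess, integrable_indicator_iff measurableSet_Icc]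
  refine Integrable.of_bound ((hu.sub hv).max measurable_const).aestronglyMeasurable 1 ?_
  filter_upwards with t
  rw [Real.norm_of_nonneg (le_max_right _ _)]
  exact max_le (by linarith [(hu1 t).2, (hv1 t).1]) zero_le_one

lemma tailInt_excess_sub {u v : ℝ → ℝ} (hu : Measurable u) (hv : Measurable v)
    (hu1 : ∀ t, u t ∈ Icc (0 : ℝ) 1) (hv1 : ∀ t, v t ∈ Icc (0 : ℝ) 1) {x : ℝ}
    (hx : x ∈ Icc (0 : ℝ) 1) :
    tailInt (excess u v) x - tailInt (excess v u) x = (∫ t in x..1, u t) - ∫ t in x..1, v t := by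
  have hi : ∀ w : ℝ → ℝ, Measurable w → (∀ t, w t ∈ Icc (0 : ℝ) 1) →
      IntervalIntegrable w volume x 1 := by
    intro w hw hw1
    rw [intervalIntegrable_iff_integrableOn_Icc_of_le hx.2]
    refine Integrable.of_bound hw.aestronglyMeasurable 1 ?_
    filter_upwards with t
    rw [Real.norm_of_nonneg (hw1 t).1]
    exact (hw1 t).2
  rw [tailInt, tailInt, ← intervalIntegral.integral_sub
    (excess_integrable hu hv hu1 hv1).intervalIntegrable
    (excess_integrable hv hu hv1 hu1).intervalIntegrable,
    ← intervalIntegral.integral_sub (hi u hu hu1) (hi v hv hv1)]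
  apply intervalIntegral.integral_congr
  intro t ht
  rw [uIcc_of_le hx.2] at ht
  have ht' : t ∈ Icc (0 : ℝ) 1 := ⟨hx.1.trans ht.1, ht.2⟩
  rcases le_total (u t) (v t) with h | h
  · simp [excess_of_le h, excess_of_ge ht' h]
  · simp [excess_of_le h, excess_of_ge ht' h]

lemma weight_mem {c q d : ℝ} (h : c ≤ q ∧ q ≤ d ∨ d ≤ q ∧ q ≤ c) :
    (q - c) / (d - c) ∈ Icc (0 : ℝ) 1 := by
  rcases h with ⟨h1, h2⟩ | ⟨h1, h2⟩
  · exact ⟨div_nonneg (by linarith) (by linarith), div_le_one_of_le₀ (by linarith) (by linarith)⟩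
  · rw [← neg_div_neg_eq]
    exact ⟨div_nonneg (by linarith) (by linarith), div_le_one_of_le₀ (by linarith) (by linarith)⟩

/-- The truncation of a real number to `[0,1]`. -/
def clampUnit (z : ℝ) : ℝ := max 0 (min 1 z)

lemma clampUnit_mem (z : ℝ) : clampUnit z ∈ Icc (0 : ℝ) 1 :=
  ⟨le_max_left _ _, max_le zero_le_one (min_le_left _ _)⟩

lemma clampUnit_of_mem {z : ℝ} (h : z ∈ Icc (0 : ℝ) 1) : clampUnit z = z := by
  rw [clampUnit, min_eq_right h.2, max_eq_right h.1]

lemma clampUnit_mono : Monotone clampUnit :=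
  fun _ _ h => max_le_max_left 0 (min_le_min_left 1 h)

lemma exists_kernel_of_tail_le {Q g : ℝ → ℝ} (hQm : Monotone Q) (hg : Measurable g)
    (hQ1 : ∀ t, Q t ∈ Icc (0 : ℝ) 1) (hg1 : ∀ t, g t ∈ Icc (0 : ℝ) 1)
    (hmaj : ∀ x ∈ Icc (0 : ℝ) 1, (∫ t in x..1, Q t) ≤ ∫ t in x..1, g t) :
    ∃ p : ℝ × ℝ → ℝ, Measurable p ∧ (∀ x, p x ∈ Icc (0 : ℝ) 1) ∧
      (∀ᵐ t ∂(volume.restrict (Icc (0 : ℝ) 1)), ∫ y in Icc (0 : ℝ) 1, p (t, y) = Q t) ∧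
      ∀ y, ∫ t in Icc (0 : ℝ) 1, p (t, y) ≤ ∫ t in Icc (0 : ℝ) 1, stepFun (g t) y := by
  have hQ := hQm.measurable
  set a := excess Q g with ha_def
  set b := excess g Q with hb_def
  have ha := excess_integrable hQ hg hQ1 hg1
  have hb := excess_integrable hg hQ hg1 hQ1
  have ha0 := excess_nonneg Q g
  have hb0 := excess_nonneg g Q
  have ham := excess_measurable hQ hg
  have hbm := excess_measurable hg hQ
  have hab : ∀ t ∈ Icc (0 : ℝ) 1, tailInt a t ≤ tailInt b t := fun t ht => by
    linarith [tailInt_excess_sub hQ hg hQ1 hg1 ht, hmaj t ht]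
  set T : ℝ → ℝ := fun t => tailInv b (tailInt a t) with hT
  set S : ℝ → ℝ := fun t => tailInv a (tailInt b t) with hS
  have hTm : Measurable T :=
    (tailInv_antitone hb).measurable.comp (tailInt_continuous ha).measurable
  have hSm : Measurable S :=
    (tailInv_antitone ha).measurable.comp (tailInt_continuous hb).measurable
  have hI : ∀ᵐ t ∂(volume.restrict (Icc (0 : ℝ) 1)), t ∈ Icc (0 : ℝ) 1 :=
    ae_restrict_mem measurableSet_Icc
  have hup : ∀ᵐ t ∂(volume.restrict (Icc (0 : ℝ) 1)), g t < Q t → Q t < g (T t) := by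
    filter_upwards [transport_up_ae ha ha0 ham hb hb0 hbm hab, hI] with t h htI hlt
    obtain ⟨h1, h2⟩ := h (by rw [excess_of_ge htI hlt.le]; linarith)
    exact (hQm h1).trans_lt (lt_of_excess_pos h2)
  have hdown : ∀ᵐ t ∂(volume.restrict (Icc (0 : ℝ) 1)), Q t < g t →
      tailInt b t ≤ tailInt a 0 → g (S t) < Q t := by
    filter_upwards [transport_down_ae ha ha0 ham hb hb0 hbm hab, hI] with t h htI hlt hm
    obtain ⟨h1, h2⟩ := h (by rw [excess_of_ge htI hlt.le]; linarith) hm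
    exact (lt_of_excess_pos h2).trans_le (hQm h1)
  set R : ℝ → ℝ := fun t => if g t < Q t then g (T t) else g (S t) with hR
  have hRm : Measurable R :=
    Measurable.ite (measurableSet_lt hg hQ) (hg.comp hTm) (hg.comp hSm)
  set γ : ℝ → ℝ := fun t => clampUnit ((Q t - g t) / (R t - g t)) with hγ
  have hγm : Measurable γ := clampUnit_mono.measurable.comp ((hQ.sub hg).div (hRm.sub hg))
  set M : Set ℝ := {t | g t < Q t} ∪ {t | tailInt b t ≤ tailInt a 0} with hM
  have hMm : MeasurableSet M := (measurableSet_lt hg hQ).union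
    (measurableSet_le (tailInt_continuous hb).measurable measurable_const)
  classical
  set p : ℝ × ℝ → ℝ := fun x => if x.1 ∈ M then
    (1 - γ x.1) * stepFun (g x.1) x.2 + γ x.1 * stepFun (R x.1) x.2
    else stepFun (Q x.1) x.2 with hp
  have hpm : Measurable p := by
    refine Measurable.ite (measurable_fst hMm) ?_ ?_
    · have h1 : Measurable fun x : ℝ × ℝ => stepFun (g x.1) x.2 :=
        (hg.comp measurable_fst).stepFun_comp measurable_snd
      have h2 : Measurable fun x : ℝ × ℝ => stepFun (R x.1) x.2 :=
        (hRm.comp measurable_fst).stepFun_comp measurable_snd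
      have h3 : Measurable fun x : ℝ × ℝ => γ x.1 := hγm.comp measurable_fst
      exact ((measurable_const.sub h3).mul h1).add (h3.mul h2)
    · exact (hQ.comp measurable_fst).stepFun_comp measurable_snd
  have hp1 : ∀ x, p x ∈ Icc (0 : ℝ) 1 := by
    intro x
    have h0 := stepFun_nonneg
    have h1 := stepFun_le_one
    simp only [hp]
    split_ifs
    · exact (convex_Icc (0 : ℝ) 1) ⟨h0 _ _, h1 _ _⟩ ⟨h0 _ _, h1 _ _⟩
        (sub_nonneg.2 (clampUnit_mem _).2) (clampUnit_mem _).1 (by ring)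
    · exact ⟨h0 _ _, h1 _ _⟩
  have hweight : ∀ᵐ t ∂(volume.restrict (Icc (0 : ℝ) 1)), t ∈ M →
      γ t = (Q t - g t) / (R t - g t) ∧ (R t = g t → Q t = g t) := by
    filter_upwards [hup, hdown] with t h1 h2 htM
    rcases lt_trichotomy (g t) (Q t) with h | h | h
    · have := h1 h
      simp only [hγ, hR, if_pos h]
      exact ⟨clampUnit_of_mem (weight_mem (Or.inl ⟨h.le, this.le⟩)), fun h' => by linarith⟩
    · simp [hγ, h, clampUnit]
    · have := h2 h (htM.resolve_left (not_lt.2 h.le))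
      simp only [hγ, hR, if_neg (not_lt.2 h.le)]
      exact ⟨clampUnit_of_mem (weight_mem (Or.inr ⟨this.le, h.le⟩)), fun h' => by linarith⟩
  refine ⟨p, hpm, hp1, ?_, fun y => ?_⟩
  · filter_upwards [hweight] with t ht
    by_cases htM : t ∈ M
    · obtain ⟨h1, h2⟩ := ht htM
      have hRI : R t ∈ Icc (0 : ℝ) 1 := by
        simp only [hR]; split_ifs <;> exact hg1 _
      have hs : ∀ c w : ℝ,
          Integrable (fun y => w * stepFun c y) (volume.restrict (Icc (0 : ℝ) 1)) := fun c w =>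
        (integrable_stepFun (k := fun y => y) measurable_const measurable_id).const_mul w
      simp only [hp, if_pos htM]
      rw [integral_add (hs _ _) (hs _ _),
        integral_const_mul, integral_const_mul, integral_stepFun (hg1 t), integral_stepFun hRI, h1]
      by_cases h : R t - g t = 0
      · rw [h, div_zero, h2 (sub_eq_zero.1 h)]
        ring
      · field_simp
        ring
    · simp only [hp, if_neg htM]
      exact integral_stepFun (hQ1 t)
  · set h : ℝ → ℝ → ℝ := fun s t => (stepFun (g t) y - stepFun (g s) y) / (g t - g s) with hh_def
    have hh : Measurable (Function.uncurry h) := by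
      have h1 := (hg.comp (measurable_snd (α := ℝ) (β := ℝ))).stepFun_comp
        (measurable_const (a := y))
      have h2 := (hg.comp (measurable_fst (α := ℝ) (β := ℝ))).stepFun_comp
        (measurable_const (a := y))
      exact (h1.sub h2).div ((hg.comp measurable_snd).sub (hg.comp measurable_fst))
    have htrans := integral_transport ha ha0 ham hb hb0 hbm hab hh
    have hdiff : ∀ c d, |stepFun c y - stepFun d y| ≤ 1 := fun c d => by
      rw [abs_le]
      constructor <;> linarith [stepFun_nonneg c y, stepFun_nonneg d y, stepFun_le_one c y,
        stepFun_le_one d y]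
    have hbound : ∀ c d D w : ℝ, w / D ∈ Icc (0 : ℝ) 1 →
        ‖w * ((stepFun c y - stepFun d y) / D)‖ ≤ 1 := by
      intro c d D w hw
      rw [mul_div_assoc', mul_div_right_comm, norm_mul, Real.norm_of_nonneg hw.1]
      exact mul_le_one₀ hw.2 (norm_nonneg _) (hdiff c d)
    have hia : Integrable (fun t => a t * h t (T t)) (volume.restrict (Icc (0 : ℝ) 1)) := by
      refine Integrable.of_bound (ham.mul (hh.comp (measurable_id.prodMk hTm))).aestronglyMeasurable
        1 ?_
      filter_upwards [hup, hI] with t h1 htI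
      rcases lt_or_ge (g t) (Q t) with hlt | hle
      · rw [ha_def, excess_of_ge htI hlt.le]
        exact hbound _ _ _ _ (weight_mem (Or.inl ⟨hlt.le, (h1 hlt).le⟩))
      · simp [ha_def, excess_of_le hle]
    have hib : Integrable (fun t => b t * (if tailInt b t ≤ tailInt a 0 then h (S t) t else 0))
        (volume.restrict (Icc (0 : ℝ) 1)) := by
      refine Integrable.of_bound (hbm.mul (Measurable.ite
        (measurableSet_le (tailInt_continuous hb).measurable measurable_const)
        (hh.comp (hSm.prodMk measurable_id)) measurable_const)).aestronglyMeasurable 1 ?_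
      filter_upwards [hdown, hI] with t h1 htI
      rcases lt_or_ge (Q t) (g t) with hlt | hle
      · split_ifs with hm
        · rw [hb_def, excess_of_ge htI hlt.le]
          refine hbound _ _ _ _ ?_
          rw [← neg_div_neg_eq, neg_sub, neg_sub]
          exact weight_mem (Or.inr ⟨(h1 hlt hm).le, hlt.le⟩)
        · simp
      · simp [hb_def, excess_of_le hle]
    have his : Integrable (fun t => stepFun (g t) y) (volume.restrict (Icc (0 : ℝ) 1)) :=
      integrable_stepFun hg measurable_const
    have hip : Integrable (fun t => p (t, y)) (volume.restrict (Icc (0 : ℝ) 1)) := by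
      refine Integrable.of_bound (hpm.comp measurable_prodMk_right).aestronglyMeasurable 1 ?_
      filter_upwards with t
      rw [Real.norm_of_nonneg (hp1 _).1]
      exact (hp1 _).2
    have hkey : ∀ᵐ t ∂(volume.restrict (Icc (0 : ℝ) 1)), p (t, y) ≤
        stepFun (g t) y + a t * h t (T t) -
          b t * (if tailInt b t ≤ tailInt a 0 then h (S t) t else 0) := by
      filter_upwards [hweight, hI] with t hw htI
      by_cases htM : t ∈ M
      · obtain ⟨h1, -⟩ := hw htM
        simp only [hp, if_pos htM, h1]
        rcases lt_or_ge (g t) (Q t) with hlt | hle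
        · rw [ha_def, excess_of_ge htI hlt.le, hb_def, excess_of_le hlt.le]
          simp only [hR, if_pos hlt, hh_def]
          apply le_of_eq
          ring
        · rw [ha_def, excess_of_le hle, hb_def, excess_of_ge htI hle]
          have hm : tailInt b t ≤ tailInt a 0 := htM.resolve_left (not_lt.2 hle)
          rw [hb_def, ha_def] at hm
          simp only [hR, if_neg (not_lt.2 hle), hh_def, if_pos hm]
          rw [← neg_sub (g (S t)) (g t), div_neg]
          apply le_of_eq
          ring
      · simp only [hp, if_neg htM]
        simp only [hM, mem_union, mem_ofPred_eq, not_or, not_lt] at htM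
        rw [if_neg htM.2, ha_def, excess_of_le htM.1]
        simpa using stepFun_mono htM.1 y
    refine (integral_mono_ae hip ((his.add hia).sub hib) hkey).trans_eq ?_
    rw [integral_sub' (his.add hia) hib, integral_add' his hia, htrans]
    ring

lemma ginv_mem_s19 (q : ℝ → ℝ) (z : ℝ) : ginv q z ∈ Icc (0 : ℝ) 1 := by
  have hb : ∀ x ∈ insert 1 {x | x ∈ Icc (0 : ℝ) 1 ∧ z < q x}, (0 : ℝ) ≤ x := by
    rintro x (rfl | hx)
    · exact zero_le_one
    · exact hx.1.1
  exact ⟨le_csInf (insert_nonempty _ _) hb, csInf_le ⟨0, hb⟩ (mem_insert _ _)⟩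

lemma ginv_le (q : ℝ → ℝ) {x z : ℝ} (hx : x ∈ Icc (0 : ℝ) 1) (h : z < q x) : ginv q z ≤ x := by
  refine csInf_le ⟨0, ?_⟩ (mem_insert_of_mem _ ⟨hx, h⟩)
  rintro x (rfl | hx)
  · exact zero_le_one
  · exact hx.1.1

lemma ginv_mono (q : ℝ → ℝ) : Monotone (ginv q) := by
  intro z w hzw
  refine le_csInf (insert_nonempty _ _) ?_
  rintro x (rfl | hx)
  · exact (ginv_mem_s19 q z).2
  · exact ginv_le q hx.1 (hzw.trans_lt hx.2)

lemma le_ginv_iff {q : ℝ → ℝ} (hq : MonoLC q) {y : ℝ} (hy : y ∈ Ioc (0 : ℝ) 1) (z : ℝ) :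
    y ≤ ginv q z ↔ q y ≤ z := by
  constructor
  · intro h
    by_contra! hz
    have h1 := (hq.2.2 y hy).eventually (lt_mem_nhds hz)
    have h2 : ∀ᶠ x in nhdsWithin y (Iio y), x ∈ Ioo 0 y := Ioo_mem_nhdsLT hy.1
    obtain ⟨x, hx, hx'⟩ := (h1.and h2).exists
    have := ginv_le q ⟨hx'.1.le, hx'.2.le.trans hy.2⟩ hx
    linarith [hx'.2]
  · intro h
    refine le_csInf (insert_nonempty _ _) ?_
    rintro x (rfl | hx)
    · exact hy.2
    · by_contra! hlt
      have := hq.1 hx.1 ⟨hy.1.le, hy.2⟩ hlt.le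
      linarith [hx.2]

lemma integral_stepFun_ginv {q : ℝ → ℝ} (hq : MonoLC q) {x y : ℝ} (hx : x ∈ Icc (0 : ℝ) 1)
    (hy : y ∈ Ioc (0 : ℝ) 1) :
    ∫ t in Icc x 1, stepFun (ginv q t) y = 1 - max x (q y) := by
  have h : (fun t => stepFun (ginv q t) y) = (Ici (q y)).indicator 1 := by
    funext t
    simp [stepFun, indicator, le_ginv_iff hq hy]
  rw [h, integral_indicator_one measurableSet_Ici, measureReal_restrict_apply measurableSet_Ici]
  have h2 : Ici (q y) ∩ Icc x 1 = Icc (max x (q y)) 1 := by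
    ext t
    simp only [mem_inter_iff, mem_Ici, mem_Icc, max_le_iff]
    tauto
  rw [h2]
  simp [hx.2, (hq.2.1 y ⟨hy.1.le, hy.2⟩).2]

lemma integrable_of_mem_unit {α : Type*} [MeasurableSpace α] {μ : Measure α} [IsFiniteMeasure μ]
    {f : α → ℝ} (hf : Measurable f) (h : ∀ x, f x ∈ Icc (0 : ℝ) 1) : Integrable f μ := by
  refine Integrable.of_bound hf.aestronglyMeasurable 1 ?_
  filter_upwards with x
  rw [Real.norm_of_nonneg (h x).1]
  exact (h x).2

lemma ae_mem_Ioc : ∀ᵐ y ∂(volume.restrict (Icc (0 : ℝ) 1)), y ∈ Ioc (0 : ℝ) 1 := by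
  rw [← restrict_Ioc_eq_restrict_Icc]
  exact ae_restrict_mem measurableSet_Ioc

lemma weakMaj_of_implementable {q₁ q₂ : ℝ → ℝ} (h2 : MonoLC q₂) {p₁ p₂ : ℝ × ℝ → ℝ}
    (hm₁ : Measurable p₁) (hm₂ : Measurable p₂) (hp₁ : ∀ x, p₁ x ∈ Icc (0 : ℝ) 1)
    (hp₂ : ∀ x, p₂ x ∈ Icc (0 : ℝ) 1)
    (hadd : ∀ t ∈ Icc (0 : ℝ) 1, ∀ y ∈ Icc (0 : ℝ) 1, p₁ (t, y) + p₂ (t, y) ≤ 1)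
    (hq₁ : ∀ᵐ t ∂(volume.restrict (Icc (0 : ℝ) 1)), q₁ t = ∫ y in Icc (0 : ℝ) 1, p₁ (t, y))
    (hq₂ : ∀ᵐ t ∂(volume.restrict (Icc (0 : ℝ) 1)), q₂ t = ∫ y in Icc (0 : ℝ) 1, p₂ (y, t)) :
    WeakMaj q₁ (ginv q₂) := by
  intro x hx
  have hsub : Icc x 1 ⊆ Icc (0 : ℝ) 1 := Icc_subset_Icc_left hx.1
  have hgm := (ginv_mono q₂).measurable
  have hi₁ : ∀ (y : ℝ) (s : Set ℝ) [IsFiniteMeasure (volume.restrict s)],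
      Integrable (fun t => p₁ (t, y)) (volume.restrict s) := fun y s _ =>
    integrable_of_mem_unit (hm₁.comp measurable_prodMk_right) fun t => hp₁ (t, y)
  have hi₂ : ∀ (y : ℝ) (s : Set ℝ) [IsFiniteMeasure (volume.restrict s)],
      Integrable (fun t => p₂ (t, y)) (volume.restrict s) := fun y s _ =>
    integrable_of_mem_unit (hm₂.comp measurable_prodMk_right) fun t => hp₂ (t, y)
  have hsm : Measurable (Function.uncurry fun t y => stepFun (ginv q₂ t) y) :=
    (hgm.comp measurable_fst).stepFun_comp measurable_snd
  have hcol : ∀ᵐ y ∂(volume.restrict (Icc (0 : ℝ) 1)),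
      ∫ t in Icc x 1, p₁ (t, y) ≤ ∫ t in Icc x 1, stepFun (ginv q₂ t) y := by
    filter_upwards [hq₂, ae_mem_Ioc] with y hy hyI
    rw [integral_stepFun_ginv h2 hx hyI, ← min_sub_sub_left, le_min_iff]
    constructor
    · calc ∫ t in Icc x 1, p₁ (t, y) ≤ ∫ t in Icc x 1, (1 : ℝ) :=
            integral_mono (hi₁ y _) (integrable_const 1) fun t => (hp₁ (t, y)).2
        _ = 1 - x := by simp [hx.2]
    · calc ∫ t in Icc x 1, p₁ (t, y) ≤ ∫ t in Icc (0 : ℝ) 1, p₁ (t, y) :=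
            setIntegral_mono_set (hi₁ y _) (Filter.Eventually.of_forall fun t => (hp₁ (t, y)).1)
              hsub.eventuallyLE
        _ ≤ ∫ t in Icc (0 : ℝ) 1, (1 - p₂ (t, y)) := by
            refine setIntegral_mono_on (hi₁ y _) ((integrable_const 1).sub (hi₂ y _))
              measurableSet_Icc fun t ht => ?_
            linarith [hadd t ht y ⟨hyI.1.le, hyI.2⟩]
        _ = 1 - q₂ y := by
            rw [integral_sub (integrable_const 1) (hi₂ y _), ← hy]
            simp
  calc (∫ z in x..1, q₁ z) = ∫ z in Icc x 1, q₁ z := by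
        rw [intervalIntegral.integral_of_le hx.2, integral_Icc_eq_integral_Ioc]
    _ = ∫ z in Icc x 1, ∫ y in Icc (0 : ℝ) 1, p₁ (z, y) :=
        integral_congr_ae (ae_restrict_of_ae_restrict_of_subset hsub hq₁)
    _ = ∫ y in Icc (0 : ℝ) 1, ∫ z in Icc x 1, p₁ (z, y) :=
        integral_integral_swap (f := fun z y => p₁ (z, y)) (integrable_of_mem_unit hm₁ hp₁)
    _ ≤ ∫ y in Icc (0 : ℝ) 1, ∫ z in Icc x 1, stepFun (ginv q₂ z) y :=
        integral_mono_ae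
          (Integrable.integral_prod_right (f := p₁) (integrable_of_mem_unit hm₁ hp₁))
          (Integrable.integral_prod_right (integrable_of_mem_unit hsm
            fun _ => ⟨stepFun_nonneg _ _, stepFun_le_one _ _⟩)) hcol
    _ = ∫ z in Icc x 1, ∫ y in Icc (0 : ℝ) 1, stepFun (ginv q₂ z) y :=
        (integral_integral_swap (integrable_of_mem_unit hsm
          fun _ => ⟨stepFun_nonneg _ _, stepFun_le_one _ _⟩)).symm
    _ = ∫ z in Icc x 1, ginv q₂ z := by simp only [integral_stepFun (ginv_mem_s19 q₂ _)]
    _ = ∫ z in x..1, ginv q₂ z := by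
        rw [intervalIntegral.integral_of_le hx.2, integral_Icc_eq_integral_Ioc]

lemma MonoLC.comp_clampUnit_mono {q : ℝ → ℝ} (h : MonoLC q) :
    Monotone fun t => q (clampUnit t) :=
  fun _ _ hst => h.1 (clampUnit_mem _) (clampUnit_mem _) (clampUnit_mono hst)

lemma exists_implementation_of_weakMaj {q₁ q₂ : ℝ → ℝ} (h1 : MonoLC q₁) (h2 : MonoLC q₂)
    (h : WeakMaj q₁ (ginv q₂)) :
    ∃ p₁ p₂ : ℝ × ℝ → ℝ, Measurable p₁ ∧ Measurable p₂ ∧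
      (∀ x, p₁ x ∈ Icc (0 : ℝ) 1) ∧ (∀ x, p₂ x ∈ Icc (0 : ℝ) 1) ∧ (∀ x, p₁ x + p₂ x ≤ 1) ∧
      (∀ᵐ t ∂(volume.restrict (Icc (0 : ℝ) 1)), q₁ t = ∫ y in Icc (0 : ℝ) 1, p₁ (t, y)) ∧
      (∀ᵐ t ∂(volume.restrict (Icc (0 : ℝ) 1)), q₂ t = ∫ y in Icc (0 : ℝ) 1, p₂ (y, t)) := by
  obtain ⟨p, hpm, hp1, hrow, hcol⟩ := exists_kernel_of_tail_le h1.comp_clampUnit_mono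
    (ginv_mono q₂).measurable (fun t => h1.2.1 _ (clampUnit_mem t)) (ginv_mem_s19 q₂) (by
      intro x hx
      refine le_of_eq_of_le (intervalIntegral.integral_congr fun t ht => ?_) (h x hx)
      rw [uIcc_of_le hx.2] at ht
      simp only [clampUnit_of_mem ⟨hx.1.trans ht.1, ht.2⟩])
  set r : ℝ → ℝ := fun y => ∫ t in Icc (0 : ℝ) 1, p (t, y) with hr
  have hrm : Measurable r := (StronglyMeasurable.integral_prod_left' hpm.stronglyMeasurable).measurable
  set w : ℝ → ℝ := fun y => clampUnit (q₂ (clampUnit y) / (1 - r y)) with hw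
  have hwm : Measurable w := clampUnit_mono.measurable.comp
    (h2.comp_clampUnit_mono.measurable.div (measurable_const.sub hrm))
  have hw1 : ∀ y, w y ∈ Icc (0 : ℝ) 1 := fun y => clampUnit_mem _
  refine ⟨p, fun x => (1 - p x) * w x.2, hpm,
    (measurable_const.sub hpm).mul (hwm.comp measurable_snd), hp1, fun x => ?_, fun x => ?_, ?_, ?_⟩
  · have h3 := sub_nonneg.2 (hp1 x).2
    exact ⟨mul_nonneg h3 (hw1 _).1, mul_le_one₀ (by linarith [(hp1 x).1]) (hw1 _).1 (hw1 _).2⟩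
  · have := mul_le_of_le_one_right (sub_nonneg.2 (hp1 x).2) (hw1 x.2).2
    linarith
  · filter_upwards [hrow, ae_mem_Ioc] with t ht htI
    rw [ht, clampUnit_of_mem ⟨htI.1.le, htI.2⟩]
  · filter_upwards [ae_mem_Ioc] with y hy
    have hyI : y ∈ Icc (0 : ℝ) 1 := ⟨hy.1.le, hy.2⟩
    have hq := h2.2.1 y hyI
    have hry : r y ≤ 1 - q₂ y := by
      have := hcol y
      rwa [integral_stepFun_ginv h2 (by simp) hy, max_eq_right hq.1] at this
    have hi : Integrable (fun t => p (t, y)) (volume.restrict (Icc (0 : ℝ) 1)) :=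
      integrable_of_mem_unit (hpm.comp measurable_prodMk_right) fun t => hp1 (t, y)
    have hint : ∫ t in Icc (0 : ℝ) 1, (1 - p (t, y)) = 1 - r y := by
      rw [integral_sub (integrable_const 1) hi]
      simp [hr]
    have hwy : w y = q₂ y / (1 - r y) := by
      simp only [hw, clampUnit_of_mem hyI]
      exact clampUnit_of_mem ⟨div_nonneg hq.1 (by linarith [hq.1]),
        div_le_one_of_le₀ (by linarith) (by linarith [hq.1])⟩
    rw [integral_mul_const, hint, hwy]
    by_cases h0 : 1 - r y = 0
    · rw [h0, zero_mul]
      linarith [hq.1]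
    · field_simp

end Implementation

/-- two-bidder reduced-form auctions: the pair `(q̃₁, q̃₂)` of
nondecreasing left-continuous functions is implementable by a feasible allocation rule
`(p₁, p₂)` with `p₁ + p₂ ≤ 1` iff `q̃₁` is weakly majorized by the generalized inverse
of `q̃₂`. -/
theorem stmt19 (q₁ q₂ : ℝ → ℝ) (h1 : MonoLC q₁) (h2 : MonoLC q₂) :
    (∃ p₁ p₂ : ℝ × ℝ → ℝ, Measurable p₁ ∧ Measurable p₂ ∧
      (∀ x ∈ unitSq, p₁ x ∈ Set.Icc (0 : ℝ) 1) ∧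
      (∀ x ∈ unitSq, p₂ x ∈ Set.Icc (0 : ℝ) 1) ∧
      (∀ x ∈ unitSq, p₁ x + p₂ x ≤ 1) ∧
      (∀ᵐ t ∂(volume.restrict (Set.Icc (0 : ℝ) 1)),
        q₁ t = ∫ y in Set.Icc (0 : ℝ) 1, p₁ (t, y)) ∧
      (∀ᵐ t ∂(volume.restrict (Set.Icc (0 : ℝ) 1)),
        q₂ t = ∫ y in Set.Icc (0 : ℝ) 1, p₂ (y, t))) ↔
    WeakMaj q₁ (ginv q₂) := by
  constructor
  · rintro ⟨p₁, p₂, hm₁, hm₂, hp₁, hp₂, hadd, hq₁, hq₂⟩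
    have hsq : ∀ t ∈ Set.Icc (0 : ℝ) 1, ∀ y ∈ Set.Icc (0 : ℝ) 1, (t, y) ∈ unitSq :=
      fun t ht y hy => ⟨⟨ht.1, hy.1⟩, ⟨ht.2, hy.2⟩⟩
    have hc₁ : ∀ x ∈ unitSq, clampUnit (p₁ x) = p₁ x := fun x hx => clampUnit_of_mem (hp₁ x hx)
    have hc₂ : ∀ x ∈ unitSq, clampUnit (p₂ x) = p₂ x := fun x hx => clampUnit_of_mem (hp₂ x hx)
    have hI : ∀ᵐ t ∂(volume.restrict (Set.Icc (0 : ℝ) 1)), t ∈ Set.Icc (0 : ℝ) 1 :=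
      ae_restrict_mem measurableSet_Icc
    refine weakMaj_of_implementable h2 (p₁ := fun x => clampUnit (p₁ x))
      (p₂ := fun x => clampUnit (p₂ x)) (clampUnit_mono.measurable.comp hm₁)
      (clampUnit_mono.measurable.comp hm₂) (fun _ => clampUnit_mem _) (fun _ => clampUnit_mem _)
      (fun t ht y hy => ?_) ?_ ?_
    · rw [hc₁ _ (hsq t ht y hy), hc₂ _ (hsq t ht y hy)]
      exact hadd _ (hsq t ht y hy)
    · filter_upwards [hq₁, hI] with t ht htI
      rw [ht]
      exact setIntegral_congr_fun measurableSet_Icc fun y hy => (hc₁ _ (hsq t htI y hy)).symm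
    · filter_upwards [hq₂, hI] with t ht htI
      rw [ht]
      exact setIntegral_congr_fun measurableSet_Icc fun y hy => (hc₂ _ (hsq y hy t htI)).symm
  · intro h
    obtain ⟨p₁, p₂, hm₁, hm₂, hp₁, hp₂, hadd, hq⟩ := exists_implementation_of_weakMaj h1 h2 h
    exact ⟨p₁, p₂, hm₁, hm₂, fun x _ => hp₁ x, fun x _ => hp₂ x, fun x _ => hadd x, hq⟩
end
end
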